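/- Let q be a prime with q ≡ 1 (mod 4) and define M_{2g} = q^{2g+1}(1 − 1/q) Σ_{f ∈ M_{≤2g}, f a square} (d_2(f) φ(f)/|f|^{3/2}) Σ_{C ∈ M_{≤g−1}, C | f^∞} |C|^{−2}, and M_{2g−1} the same with M_{≤2g} replaced by M_{≤2g−1}. Then for every ε > 0, M_{2g} + M_{2g−1} = (q^{2g+1}/ζ(2)) P_1(2g+1) + O_ε(q^{g(1+ε)}), where, writing B for the Euler product B(u) = ∏_P (1 + u^{d(P)}(u^{d(P)} − 3)/((|P|+1)(1 + u^{d(P)}))), P_1(x) = x^3·B(1/q)(1−q^{−1})/24 + x^2·[B(1/q)(1+q^{−1})/4 − B'(1/q)(1−q^{−1})/(4q)] + x·[11B(1/q)(1−q^{−1})/24 + 3B'(1/q)(1−q^{−1})/(2q) − 2B'(1/q)/q + B''(1/q)(1−q^{−1})/(2q^2)] + B(1/q)(1+q^{−1})/4 − B'(1/q)(1−q^{−1})/(4q) + 2B'(1/q)/q^2 + 2B''(1/q)/q^3 − B'''(1/q)(1−q^{−1})/(3q^3). -/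

import Mathlib

/- Setting: `F_q[x]` with `q` prime, `q ≡ 1 (mod 4)`.  `M_n` denotes the monic
polynomials of degree `n`, `M_{≤n}` those of degree at most `n`, `H_n` the monic
squarefree polynomials of degree `n`. -/

open Polynomial

noncomputable section

attribute [local instance] Classical.propDecidable

abbrev Fqx (q : ℕ) := Polynomial (ZMod q)

/-- The (sub)type of monic irreducible polynomials over `F_q`. -/
abbrev MIrr (q : ℕ) := {P : Fqx q // P.Monic ∧ Irreducible P}

/-- The norm `|f| = q ^ deg f`, as a complex number. -/
def nm (q : ℕ) (f : Fqx q) : ℂ := (q : ℂ) ^ f.natDegree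

/-- The monic polynomial `X ^ n + ∑ i < n, c i * X ^ i` of degree `n`; as `c` runs over
`Fin n → ZMod q`, this enumerates the monic polynomials of degree `n` exactly once. -/
def monicOf (q n : ℕ) (c : Fin n → ZMod q) : Fqx q :=
  X ^ n + ∑ i : Fin n, C (c i) * X ^ (i : ℕ)

/-- The polynomial `∑ i < n, c i * X ^ i` of degree `< n`; as `c` runs over
`Fin n → ZMod q`, this enumerates the residues modulo a polynomial of degree `n`. -/
def polyOf (q n : ℕ) (c : Fin n → ZMod q) : Fqx q :=
  ∑ i : Fin n, C (c i) * X ^ (i : ℕ)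

/-- The sum of `F` over the monic polynomials of degree `n` (empty if `n < 0`). -/
def sumMn (q : ℕ) [NeZero q] (n : ℤ) (F : Fqx q → ℂ) : ℂ :=
  if 0 ≤ n then ∑ c : Fin n.toNat → ZMod q, F (monicOf q n.toNat c) else 0

/-- The sum of `F` over the monic polynomials of degree at most `n` (empty if `n < 0`). -/
def sumMle (q : ℕ) [NeZero q] (n : ℤ) (F : Fqx q → ℂ) : ℂ :=
  ∑ m ∈ Finset.range (n + 1).toNat, sumMn q m F

/-- The sum of `F` over `H_n`, the monic squarefree polynomials of degree `n`. -/
def sumH (q : ℕ) [NeZero q] (n : ℕ) (F : Fqx q → ℂ) : ℂ :=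
  ∑ c : Fin n → ZMod q,
    if Squarefree (monicOf q n c) then F (monicOf q n c) else 0

/-- The quadratic residue symbol `(f | P)` for `P` monic irreducible:  it is `0` if
`P ∣ f`, `1` if `P ∤ f` and `f` is a square modulo `P`, and `-1` otherwise. -/
def legSym (q : ℕ) (f P : Fqx q) : ℤ :=
  if P ∣ f then 0 else if ∃ g : Fqx q, P ∣ (g ^ 2 - f) then 1 else -1

/-- The Jacobi symbol `(f | u)`, extending the quadratic residue symbol
multiplicatively in the lower entry. -/
def jacSym (q : ℕ) [Fact q.Prime] (f u : Fqx q) : ℤ :=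
  if u = 0 then (if IsUnit f then 1 else 0)
  else ((UniqueFactorizationMonoid.factors u).map fun P => legSym q f P).prod

/-- The character `χ_D(f) = (D | f)`, as a complex number. -/
def chi (q : ℕ) [Fact q.Prime] (D f : Fqx q) : ℂ := jacSym q D f

/-- `d_k(f)`: the number of ways of writing `f` as an ordered product of `k` monic
polynomials. -/
def dk (q k : ℕ) (f : Fqx q) : ℕ :=
  Nat.card {t : Fin k → Fqx q // (∀ i, (t i).Monic) ∧ ∏ i, t i = f}

/-- The exponential `e(a/f) = exp(2πi a₁/q)`, where `a₁ ∈ F_q ≅ ℤ/q` is the coefficient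
of `1/x` in the Laurent expansion of `a/f` at infinity, i.e. the coefficient of
`x^(deg f - 1)` in `a mod f`. -/
def eQ (q : ℕ) (f a : Fqx q) : ℂ :=
  Complex.exp (2 * (Real.pi : ℂ) * Complex.I * (((a %ₘ f).coeff (f.natDegree - 1)).val : ℂ) / q)

/-- The generalized Gauss sum `G(V, χ_f) = ∑_{u mod f} χ_f(u) e(uV/f)`. -/
def gSum (q : ℕ) [Fact q.Prime] (V f : Fqx q) : ℂ :=
  ∑ c : Fin f.natDegree → ZMod q,
    chi q f (polyOf q f.natDegree c) * eQ q f (polyOf q f.natDegree c * V)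

/-- `L(1/2, χ_D)`: since `L(s, χ_D) = ∑_{f ∈ M} χ_D(f) |f|^{-s}` is a polynomial of
degree `deg D - 1` in `q^{-s}` (for `D` squarefree of odd degree), this is the finite
sum `∑_{n < deg D} (∑_{f ∈ M_n} χ_D(f)) q^{-n/2}`. -/
def Lhalf (q : ℕ) [Fact q.Prime] (D : Fqx q) : ℂ :=
  ∑ n ∈ Finset.range D.natDegree,
    sumMn q n (fun f => chi q D f) / (Real.sqrt ((q : ℝ) ^ n) : ℂ)

/-- The L-series `L(w, χ_V) = ∑_{f ∈ M} χ_V(f) w^(deg f)`. -/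
def Lser (q : ℕ) [Fact q.Prime] (V : Fqx q) (w : ℂ) : ℂ :=
  ∑' f : {f : Fqx q // f.Monic}, chi q V f.1 * w ^ f.1.natDegree

/-- The Euler phi function: the number of units in `F_q[x]/(f)`. -/
def polyPhi (q : ℕ) [Fact q.Prime] (f : Fqx q) : ℕ :=
  Nat.card ((Fqx q ⧸ Ideal.span {f}))ˣ

/-- `Z(u) = (1 - qu)⁻¹`. -/
def Zf (q : ℕ) (u : ℂ) : ℂ := (1 - q * u)⁻¹

/-- The Euler product `B(u) = ∏_P (1 + u^d(u^d - 3)/((|P|+1)(1+u^d)))`, `d = d(P)`. -/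
def Bfun (q : ℕ) (u : ℂ) : ℂ :=
  ∏' P : MIrr q, (1 + u ^ P.1.natDegree * (u ^ P.1.natDegree - 3) /
    ((nm q P.1 + 1) * (1 + u ^ P.1.natDegree)))

/-- The Euler product `B_3(u)` from the third-moment main term. -/
def B3fun (q : ℕ) (u : ℂ) : ℂ :=
  ∏' P : MIrr q,
    (1 - (6 * u ^ P.1.natDegree - (15 - 6 * nm q P.1) * u ^ (2 * P.1.natDegree)
      + (20 - 8 * nm q P.1) * u ^ (3 * P.1.natDegree)
      - (15 - 3 * nm q P.1) * u ^ (4 * P.1.natDegree)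
      + 6 * u ^ (5 * P.1.natDegree) - u ^ (6 * P.1.natDegree)) / (nm q P.1 + 1))

/-- `∑_{C ∈ M_{≤ g-1}, C | f^∞} |C|⁻²`, where `C | f^∞` means that every monic
irreducible factor of `C` divides `f`. -/
def sumCdiv (q : ℕ) [NeZero q] (g : ℕ) (f : Fqx q) : ℂ :=
  sumMle q ((g : ℤ) - 1) fun Cp =>
    if ∀ P : Fqx q, P.Monic → Irreducible P → P ∣ Cp → P ∣ f
    then ((q : ℂ) ^ (2 * Cp.natDegree))⁻¹ else 0

/-- The main term `q^(2g+1) (1 - 1/q) ∑_{f ∈ M_{≤N}, f = □} d_k(f) φ(f) |f|^{-3/2}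
∑_{C ∈ M_{≤g-1}, C|f^∞} |C|⁻²`. -/
def Mterm (q : ℕ) [Fact q.Prime] (k : ℕ) (N : ℤ) (g : ℕ) : ℂ :=
  (q : ℂ) ^ (2 * g + 1) * (1 - 1 / q) * sumMle q N fun f =>
    if IsSquare f then
      (dk q k f : ℂ) * polyPhi q f / (Real.sqrt ((q : ℝ) ^ (3 * f.natDegree)) : ℂ)
        * sumCdiv q g f
    else 0

/-- The secondary main term `S_{kg}(V = □)` (with `N = kg` or `kg - 1`). -/
def Ssq (q : ℕ) [Fact q.Prime] (k : ℕ) (N : ℤ) (g : ℕ) : ℂ :=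
  (q : ℂ) ^ (2 * g + 1) * sumMle q N fun f =>
    if Even f.natDegree then
      (dk q k f : ℂ) / (Real.sqrt ((q : ℝ) ^ (3 * f.natDegree)) : ℂ) *
        sumMle q ((g : ℤ) - 1) (fun Cp =>
          if ∀ P : Fqx q, P.Monic → Irreducible P → P ∣ Cp → P ∣ f then
            ((q : ℂ) ^ (2 * Cp.natDegree))⁻¹ *
              ((q - 1) * sumMle q ((f.natDegree : ℤ) / 2 - g - 2 + Cp.natDegree)
                  (fun l => gSum q (l ^ 2) f)
                - sumMn q ((f.natDegree : ℤ) / 2 - g - 1 + Cp.natDegree)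
                    (fun l => gSum q (l ^ 2) f)
                - (q - 1) / q * sumMle q ((f.natDegree : ℤ) / 2 - g - 1 + Cp.natDegree)
                    (fun l => gSum q (l ^ 2) f)
                + (1 / q) * sumMn q ((f.natDegree : ℤ) / 2 - g + Cp.natDegree)
                    (fun l => gSum q (l ^ 2) f))
          else 0)
    else 0

/-- The odd-degree part `S_{kg,o}` (with `N = kg` or `kg - 1`). -/
def Sodd (q : ℕ) [Fact q.Prime] (k : ℕ) (N : ℤ) (g : ℕ) : ℂ :=
  (q : ℂ) ^ (2 * g + 1) * (Real.sqrt q : ℂ) * sumMle q N fun f =>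
    if Odd f.natDegree then
      (dk q k f : ℂ) / (Real.sqrt ((q : ℝ) ^ (3 * f.natDegree)) : ℂ) *
        sumMle q ((g : ℤ) - 1) (fun Cp =>
          if ∀ P : Fqx q, P.Monic → Irreducible P → P ∣ Cp → P ∣ f then
            ((q : ℂ) ^ (2 * Cp.natDegree))⁻¹ *
              (sumMn q ((f.natDegree : ℤ) - 2 * g - 2 + 2 * Cp.natDegree)
                  (fun V => gSum q V f)
                - (1 / q) * sumMn q ((f.natDegree : ℤ) - 2 * g + 2 * Cp.natDegree)
                    (fun V => gSum q V f))
          else 0)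
    else 0

/-- The even-degree, non-square-`V` part `S_{kg,e}(V ≠ □)` (with `N = kg` or `kg-1`). -/
def SevNS (q : ℕ) [Fact q.Prime] (k : ℕ) (N : ℤ) (g : ℕ) : ℂ :=
  (q : ℂ) ^ (2 * g + 1) * sumMle q N fun f =>
    if Even f.natDegree then
      (dk q k f : ℂ) / (Real.sqrt ((q : ℝ) ^ (3 * f.natDegree)) : ℂ) *
        sumMle q ((g : ℤ) - 1) (fun Cp =>
          if ∀ P : Fqx q, P.Monic → Irreducible P → P ∣ Cp → P ∣ f then
            ((q : ℂ) ^ (2 * Cp.natDegree))⁻¹ *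
              ((q - 1) * sumMle q ((f.natDegree : ℤ) - 2 * g - 3 + 2 * Cp.natDegree)
                  (fun V => if IsSquare V then 0 else gSum q V f)
                - sumMn q ((f.natDegree : ℤ) - 2 * g - 2 + 2 * Cp.natDegree)
                    (fun V => if IsSquare V then 0 else gSum q V f)
                - (q - 1) / q * sumMle q ((f.natDegree : ℤ) - 2 * g - 1 + 2 * Cp.natDegree)
                    (fun V => if IsSquare V then 0 else gSum q V f)
                + (1 / q) * sumMn q ((f.natDegree : ℤ) - 2 * g + 2 * Cp.natDegree)
                    (fun V => if IsSquare V then 0 else gSum q V f))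
          else 0)
    else 0

/-- `∏_{P | f} (1 - |P|⁻² z^{-d(P)})`, a finite product written as a `tprod`. -/
def prodC (q : ℕ) (z : ℂ) (f : Fqx q) : ℂ :=
  ∏' P : {P : Fqx q // P.Monic ∧ Irreducible P ∧ P ∣ f},
    (1 - 1 / (nm q P.1 ^ 2 * z ^ P.1.natDegree))

/-- `M(V; z, w) = ∑_{f ∈ M} d₂(f) G(V,χ_f) / (√|f| ∏_{P|f}(1 - |P|⁻²z^{-d(P)})) w^(deg f)`. -/
def Mser (q : ℕ) [Fact q.Prime] (V : Fqx q) (z w : ℂ) : ℂ :=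
  ∑' f : {f : Fqx q // f.Monic},
    (dk q 2 f.1 : ℂ) * gSum q V f.1 /
      ((Real.sqrt ((q : ℝ) ^ f.1.natDegree) : ℂ) * prodC q z f.1) * w ^ f.1.natDegree

/-- The local factor `M_P(V; z, w)`. -/
def MPf (q : ℕ) [Fact q.Prime] (V : Fqx q) (z w : ℂ) (P : Fqx q) : ℂ :=
  if P ∣ V then
    1 + (1 - 1 / (nm q P ^ 2 * z ^ P.natDegree))⁻¹ *
      ∑' b : ℕ, (dk q 2 (P ^ (b + 1)) : ℂ) * gSum q V (P ^ (b + 1)) /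
        (Real.sqrt ((q : ℝ) ^ ((b + 1) * P.natDegree)) : ℂ) * w ^ ((b + 1) * P.natDegree)
  else
    1 + 2 * (jacSym q V P : ℂ) * w ^ P.natDegree / (nm q P ^ 2 * z ^ P.natDegree - 1)
      + w ^ (2 * P.natDegree)
      - 4 * w ^ (2 * P.natDegree) / (1 - 1 / (nm q P ^ 2 * z ^ P.natDegree))
      + 2 * (jacSym q V P : ℂ) * w ^ (3 * P.natDegree) /
          (1 - 1 / (nm q P ^ 2 * z ^ P.natDegree))

/-- The local factor `R_P(l²; z, w)`. -/
def RPf (q : ℕ) [Fact q.Prime] (l : Fqx q) (z w : ℂ) (P : Fqx q) : ℂ :=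
  if P ∣ l then
    (1 - w ^ P.natDegree) ^ 2 *
      (1 + (1 - 1 / (nm q P ^ 2 * z ^ P.natDegree))⁻¹ *
        ∑' b : ℕ, (dk q 2 (P ^ (b + 1)) : ℂ) * gSum q (l ^ 2) (P ^ (b + 1)) /
          (Real.sqrt ((q : ℝ) ^ ((b + 1) * P.natDegree)) : ℂ) * w ^ ((b + 1) * P.natDegree))
  else
    1 + 2 * w ^ P.natDegree / (nm q P ^ 2 * z ^ P.natDegree - 1)
      + w ^ (2 * P.natDegree)
      - 4 * w ^ (2 * P.natDegree) / (1 - 1 / (nm q P ^ 2 * z ^ P.natDegree))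
      + 2 * w ^ (3 * P.natDegree) / (1 - 1 / (nm q P ^ 2 * z ^ P.natDegree))

/-- `R(z, w) = ∑_{l ∈ M} z^(deg l) ∏_P R_P(l²; z, w)`. -/
def Rser (q : ℕ) [Fact q.Prime] (z w : ℂ) : ℂ :=
  ∑' l : {l : Fqx q // l.Monic}, z ^ l.1.natDegree * ∏' P : MIrr q, RPf q l.1 z w P.1

/-- The local factor `F_P(z, w)`. -/
def FPf (q : ℕ) (z w : ℂ) (P : Fqx q) : ℂ :=
  (1 - w ^ P.natDegree) ^ 2 *
    (1 - (1 - 2 * nm q P ^ 2 * (w * z) ^ P.natDegree - 2 * nm q P * (w ^ 2 * z) ^ P.natDegree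
        + 2 * nm q P ^ 2 * (w * z ^ 2) ^ P.natDegree
        + (-2 * nm q P ^ 3 + 3 * nm q P ^ 2) * (w ^ 2 * z ^ 2) ^ P.natDegree
        + nm q P ^ 2 * (w ^ 4 * z ^ 2) ^ P.natDegree
        - nm q P ^ 3 * (w ^ 4 * z ^ 3) ^ P.natDegree) /
      (nm q P ^ 2 * z ^ P.natDegree * (1 - nm q P * w ^ (2 * P.natDegree) * z ^ P.natDegree)))

/-- `F(z, w) = ∏_P F_P(z, w)`. -/
def Ffull (q : ℕ) (z w : ℂ) : ℂ := ∏' P : MIrr q, FPf q z w P.1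

/-- `F(z) = F(z, 1/q)`. -/
def Fone (q : ℕ) (z : ℂ) : ℂ := Ffull q z (1 / q)

/-- `α(z) = (1/q) ∂_w F(z, w)|_{w = 1/q} / F(z, 1/q)`. -/
def alphaF (q : ℕ) (z : ℂ) : ℂ := (1 / (q : ℂ)) * deriv (Ffull q z) (1 / q) / Fone q z

/-- The explicit formula for `F(z)`:
`∏_P (1 - 1/|P|)² (1 + 2/|P| + 1/|P|³ - (z^d + z^{-d})/|P|²)`. -/
def Fexp (q : ℕ) (z : ℂ) : ℂ :=
  ∏' P : MIrr q,
    ((1 - 1 / nm q P.1) ^ 2 *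
      (1 + 2 / nm q P.1 + 1 / nm q P.1 ^ 3 -
        (z ^ P.1.natDegree + z⁻¹ ^ P.1.natDegree) / nm q P.1 ^ 2))

/-- The explicit formula for `α(z)`. -/
def alphaExp (q : ℕ) (z : ℂ) : ℂ :=
  ∑' P : MIrr q,
    2 * (P.1.natDegree : ℂ) *
      (nm q P.1 ^ 2 + z ^ P.1.natDegree * (-3 * nm q P.1 ^ 3 - 3 * nm q P.1 + nm q P.1 ^ 2)
        + z ^ (2 * P.1.natDegree) * (nm q P.1 ^ 4 - nm q P.1 ^ 3 + 4 * nm q P.1 ^ 2 - nm q P.1 + 2)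
        + z ^ (3 * P.1.natDegree) * (nm q P.1 ^ 2 - 2 * nm q P.1)) /
      ((nm q P.1 - 1) * (z ^ P.1.natDegree - nm q P.1) *
        (nm q P.1 - z ^ P.1.natDegree - 2 * nm q P.1 ^ 2 * z ^ P.1.natDegree
          - nm q P.1 ^ 3 * z ^ P.1.natDegree + nm q P.1 * z ^ (2 * P.1.natDegree)))

/-- `A(V; z, w) = ∑_{f ∈ M} w^(deg f) d₃(f) G(V,χ_f)/(√|f| ∏_{P|f}(1 - |P|⁻²z^{-d(P)}))`. -/
def Aser (q : ℕ) [Fact q.Prime] (V : Fqx q) (z w : ℂ) : ℂ :=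
  ∑' f : {f : Fqx q // f.Monic},
    w ^ f.1.natDegree * (dk q 3 f.1 : ℂ) * gSum q V f.1 /
      ((Real.sqrt ((q : ℝ) ^ f.1.natDegree) : ℂ) * prodC q z f.1)

/-- The local factor `H_P(V; z, w)` of `A(V; z, w)`. -/
def HP3f (q : ℕ) [Fact q.Prime] (V : Fqx q) (z w : ℂ) (P : Fqx q) : ℂ :=
  if P ∣ V then
    1 + (1 - 1 / (nm q P ^ 2 * z ^ P.natDegree))⁻¹ *
      ∑' i : ℕ, w ^ ((i + 1) * P.natDegree) * (dk q 3 (P ^ (i + 1)) : ℂ) *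
        gSum q V (P ^ (i + 1)) / (Real.sqrt ((q : ℝ) ^ ((i + 1) * P.natDegree)) : ℂ)
  else
    1 + 3 * (jacSym q V P : ℂ) * w ^ P.natDegree / (nm q P ^ 2 * z ^ P.natDegree - 1)
      + 3 * w ^ (2 * P.natDegree)
      - 9 * w ^ (2 * P.natDegree) / (1 - 1 / (nm q P ^ 2 * z ^ P.natDegree))
      - (jacSym q V P : ℂ) * w ^ (3 * P.natDegree)
      + 9 * (jacSym q V P : ℂ) * w ^ (3 * P.natDegree) /
          (1 - 1 / (nm q P ^ 2 * z ^ P.natDegree))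
      - 3 * w ^ (4 * P.natDegree) / (1 - 1 / (nm q P ^ 2 * z ^ P.natDegree))

/-- The local factor `A_P(l²; z, w)`. -/
def APf (q : ℕ) [Fact q.Prime] (l : Fqx q) (z w : ℂ) (P : Fqx q) : ℂ :=
  if P ∣ l then
    (1 - w ^ P.natDegree) ^ 3 *
      (1 + ∑' i : ℕ, w ^ ((i + 1) * P.natDegree) * (dk q 3 (P ^ (i + 1)) : ℂ) *
        gSum q (l ^ 2) (P ^ (i + 1)) /
          ((Real.sqrt ((q : ℝ) ^ ((i + 1) * P.natDegree)) : ℂ) *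
            (1 - 1 / (nm q P ^ 2 * z ^ P.natDegree))))
  else
    1 + 3 * w ^ P.natDegree / (nm q P ^ 2 * z ^ P.natDegree - 1)
      + 3 * w ^ (2 * P.natDegree)
      - 9 * w ^ (2 * P.natDegree) / (1 - 1 / (nm q P ^ 2 * z ^ P.natDegree))
      - w ^ (3 * P.natDegree)
      + 9 * w ^ (3 * P.natDegree) / (1 - 1 / (nm q P ^ 2 * z ^ P.natDegree))
      - 3 * w ^ (4 * P.natDegree) / (1 - 1 / (nm q P ^ 2 * z ^ P.natDegree))

/-- `C(z, w) = ∑_{l ∈ M} z^(deg l) ∏_P A_P(l²; z, w)`. -/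
def Cser (q : ℕ) [Fact q.Prime] (z w : ℂ) : ℂ :=
  ∑' l : {l : Fqx q // l.Monic}, z ^ l.1.natDegree * ∏' P : MIrr q, APf q l.1 z w P.1

/-- The local factor `H_P(z, w)`. -/
def HPf (q : ℕ) (z w : ℂ) (P : Fqx q) : ℂ :=
  (1 - w ^ P.natDegree) ^ 3 * (1 - nm q P * (w ^ 2 * z) ^ P.natDegree) ^ 3 *
    (1 + (w * z) ^ P.natDegree) ^ 3 *
    (1 + 3 * w ^ P.natDegree + 3 * nm q P * (z * w ^ 2) ^ P.natDegree
      + 3 * w ^ (2 * P.natDegree) / nm q P - 3 * (z * w) ^ P.natDegree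
      - 1 / (nm q P ^ 2 * z ^ P.natDegree) - 6 * (z * w ^ 2) ^ P.natDegree
      + nm q P * (z * w ^ 3) ^ P.natDegree - 3 * (z * w ^ 4) ^ P.natDegree
      - nm q P * (z ^ 2 * w ^ 3) ^ P.natDegree + 3 * nm q P * (z ^ 2 * w ^ 4) ^ P.natDegree
      + nm q P * (z ^ 2 * w ^ 6) ^ P.natDegree - nm q P ^ 2 * (z ^ 3 * w ^ 6) ^ P.natDegree)

/-- `H(z, w) = ∏_P H_P(z, w)`. -/
def Hfull (q : ℕ) (z w : ℂ) : ℂ := ∏' P : MIrr q, HPf q z w P.1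

end

/-- The explicit degree-3 polynomial `P₁` of the main term, in terms of `B(1/q)` and
its derivatives. -/
noncomputable def P1val (q : ℕ) (x : ℂ) : ℂ :=
  x ^ 3 * (Bfun q (1 / (q : ℂ)) * (1 - 1 / (q : ℂ)) / 24)
  + x ^ 2 * (Bfun q (1 / (q : ℂ)) * (1 + 1 / (q : ℂ)) / 4
      - deriv (Bfun q) (1 / (q : ℂ)) * (1 - 1 / (q : ℂ)) / (4 * (q : ℂ)))
  + x * (11 * Bfun q (1 / (q : ℂ)) * (1 - 1 / (q : ℂ)) / 24
      + 3 * deriv (Bfun q) (1 / (q : ℂ)) * (1 - 1 / (q : ℂ)) / (2 * (q : ℂ))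
      - 2 * deriv (Bfun q) (1 / (q : ℂ)) / (q : ℂ)
      + deriv (deriv (Bfun q)) (1 / (q : ℂ)) * (1 - 1 / (q : ℂ)) / (2 * (q : ℂ) ^ 2))
  + Bfun q (1 / (q : ℂ)) * (1 + 1 / (q : ℂ)) / 4
  - deriv (Bfun q) (1 / (q : ℂ)) * (1 - 1 / (q : ℂ)) / (4 * (q : ℂ))
  + 2 * deriv (Bfun q) (1 / (q : ℂ)) / (q : ℂ) ^ 2
  + 2 * deriv (deriv (Bfun q)) (1 / (q : ℂ)) / (q : ℂ) ^ 3
  - deriv (deriv (deriv (Bfun q))) (1 / (q : ℂ)) * (1 - 1 / (q : ℂ)) / (3 * (q : ℂ) ^ 3)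

set_option linter.unusedSectionVars false

section MonicPolynomials

variable {q : ℕ} [Fact q.Prime]

lemma degree_sum_C_mul_X_pow_lt (q n : ℕ) (c : Fin n → ZMod q) :
    (∑ i : Fin n, C (c i) * X ^ (i : ℕ) : Fqx q).degree < n := by
  refine (degree_sum_le _ _).trans_lt ((Finset.sup_lt_iff (by simp)).2 fun i _ => ?_)
  exact (degree_C_mul_X_pow_le _ _).trans_lt (by exact_mod_cast i.2)

lemma monic_monicOf (n : ℕ) (c : Fin n → ZMod q) : (monicOf q n c).Monic :=
  monic_X_pow_add (degree_sum_C_mul_X_pow_lt q n c)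

lemma natDegree_monicOf (n : ℕ) (c : Fin n → ZMod q) : (monicOf q n c).natDegree = n := by
  have h : (monicOf q n c).degree = n := by
    rw [monicOf, degree_add_eq_left_of_degree_lt] <;> rw [degree_X_pow]
    exact degree_sum_C_mul_X_pow_lt q n c
  exact natDegree_eq_of_degree_eq_some h

lemma coeff_monicOf (n : ℕ) (c : Fin n → ZMod q) (i : Fin n) :
    (monicOf q n c).coeff i = c i := by
  simp only [monicOf, coeff_add, coeff_X_pow, finsetSum_coeff, coeff_C_mul, mul_ite, mul_one,
    mul_zero]
  rw [if_neg i.2.ne, zero_add, Finset.sum_eq_single i]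
  · simp
  · intro j _ hj
    exact if_neg fun h => hj (Fin.ext h.symm)
  · simp

lemma monicOf_injective (n : ℕ) : Function.Injective (monicOf q n) := fun c d h =>
  funext fun i => by rw [← coeff_monicOf n c i, ← coeff_monicOf n d i, h]

lemma exists_monicOf_eq {f : Fqx q} (hf : f.Monic) : ∃ c, monicOf q f.natDegree c = f := by
  refine ⟨fun i => f.coeff i, ?_⟩
  conv_rhs => rw [hf.as_sum]
  rw [monicOf, Finset.sum_range]

/-- The finset of monic polynomials of degree `n`. -/
noncomputable def monicsOfDegree (q n : ℕ) [Fact q.Prime] : Finset (Fqx q) :=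
  Finset.univ.map ⟨monicOf q n, monicOf_injective n⟩

lemma mem_monicsOfDegree {n : ℕ} {f : Fqx q} :
    f ∈ monicsOfDegree q n ↔ f.Monic ∧ f.natDegree = n := by
  simp only [monicsOfDegree, Finset.mem_map, Finset.mem_univ, true_and, Function.Embedding.coeFn_mk]
  constructor
  · rintro ⟨c, rfl⟩
    exact ⟨monic_monicOf n c, natDegree_monicOf n c⟩
  · rintro ⟨hf, rfl⟩
    exact exists_monicOf_eq hf

lemma card_monicsOfDegree (n : ℕ) : (monicsOfDegree q n).card = q ^ n := by
  simp [monicsOfDegree, ZMod.card]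

lemma sumMn_natCast (n : ℕ) (F : Fqx q → ℂ) : sumMn q n F = ∑ f ∈ monicsOfDegree q n, F f := by
  simp [sumMn, monicsOfDegree]

lemma sumMle_sub_one (n : ℕ) (F : Fqx q → ℂ) :
    sumMle q ((n : ℤ) - 1) F = ∑ m ∈ Finset.range n, ∑ f ∈ monicsOfDegree q m, F f := by
  simp [sumMle, sumMn_natCast]

/-- Monic polynomials are enumerated by their degree and their coefficients. -/
noncomputable def monicEquiv (q : ℕ) [Fact q.Prime] :
    (Σ n, {f // f ∈ monicsOfDegree q n}) ≃ {f : Fqx q // f.Monic} where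
  toFun x := ⟨x.2, (mem_monicsOfDegree.1 x.2.2).1⟩
  invFun f := ⟨f.1.natDegree, f.1, mem_monicsOfDegree.2 ⟨f.2, rfl⟩⟩
  left_inv := by
    rintro ⟨n, f, hf⟩
    obtain ⟨_, rfl⟩ := mem_monicsOfDegree.1 hf
    rfl
  right_inv _ := rfl

lemma hasSum_monics_by_degree {F : Fqx q → ℂ} {s : ℂ}
    (h : HasSum (fun f : {f : Fqx q // f.Monic} => F f) s) :
    HasSum (fun n => ∑ f ∈ monicsOfDegree q n, F f) s := by
  have h' := (monicEquiv q).hasSum_iff.2 h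
  refine h'.sigma fun n => ?_
  exact Finset.hasSum (monicsOfDegree q n) F

lemma summable_norm_monics_of_le {F : Fqx q → ℂ} {b : ℕ → ℝ} (hb : Summable b)
    (h : ∀ n, ∑ f ∈ monicsOfDegree q n, ‖F f‖ ≤ b n) :
    Summable fun f : {f : Fqx q // f.Monic} => ‖F f‖ := by
  rw [← (monicEquiv q).summable_iff]
  refine (summable_sigma_of_nonneg fun _ => norm_nonneg _).2 ?_
  refine ⟨fun n => Summable.of_finite, ?_⟩
  refine Summable.of_nonneg_of_le (fun n => tsum_nonneg fun _ => norm_nonneg _) (fun n => ?_) hb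
  refine le_trans (le_of_eq ?_) (h n)
  exact Finset.tsum_subtype (monicsOfDegree q n) fun f => ‖F f‖

end MonicPolynomials

section PrimeFactors

variable {q : ℕ} [Fact q.Prime]

lemma MIrr.eq_of_dvd {P Q : MIrr q} (h : P.1 ∣ Q.1) : P = Q :=
  Subtype.ext (eq_of_monic_of_associated P.2.1 Q.2.1
    (P.2.2.associated_of_dvd Q.2.2 h))

lemma MIrr.prime (P : MIrr q) : Prime P.1 := P.2.2.prime

lemma MIrr.natDegree_pos (P : MIrr q) : 0 < P.1.natDegree :=
  P.2.2.natDegree_pos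

lemma finite_setOf_MIrr_dvd {f : Fqx q} (hf : f ≠ 0) : {P : MIrr q | P.1 ∣ f}.Finite := by
  classical
  refine Set.Finite.subset ((Finset.finite_toSet
    ((Finset.range (f.natDegree + 1)).biUnion fun n => monicsOfDegree q n)).preimage
      (Subtype.val_injective.injOn)) fun P hP => ?_
  simp only [Set.mem_preimage, Finset.coe_biUnion, Set.mem_iUnion, Finset.mem_coe,
    Finset.mem_range, mem_monicsOfDegree]
  exact ⟨P.1.natDegree, Nat.lt_succ_of_le (natDegree_le_of_dvd hP hf), P.2.1, rfl⟩

/-- The finset of monic irreducible factors of `f` (empty for `f = 0`). -/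
noncomputable def monicFactors (f : Fqx q) : Finset (MIrr q) := by
  classical exact if hf : f = 0 then ∅ else (finite_setOf_MIrr_dvd hf).toFinset

lemma mem_monicFactors {f : Fqx q} (hf : f ≠ 0) {P : MIrr q} :
    P ∈ monicFactors f ↔ P.1 ∣ f := by
  simp [monicFactors, hf]

lemma exists_MIrr_dvd {f : Fqx q} (hf : f.Monic) (h1 : f ≠ 1) : ∃ P : MIrr q, P.1 ∣ f := by
  obtain ⟨P, hP, hPi, hd⟩ := exists_monic_irreducible_factor f
    (fun h => h1 (hf.eq_one_of_isUnit h))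
  exact ⟨⟨P, hP, hPi⟩, hd⟩

end PrimeFactors

section EulerProduct

variable {q : ℕ} [Fact q.Prime]

/-- The monic polynomials all of whose monic irreducible factors lie in `S`. -/
def smoothMonics (S : Finset (MIrr q)) : Set (Fqx q) :=
  {f | f.Monic ∧ ∀ P : MIrr q, P.1 ∣ f → P ∈ S}

lemma smoothMonics_empty : smoothMonics (∅ : Finset (MIrr q)) = {1} := by
  ext f
  simp only [smoothMonics, Finset.notMem_empty, imp_false, Set.mem_ofPred_eq, Set.mem_singleton_iff]
  constructor
  · rintro ⟨hf, h⟩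
    by_contra h1
    obtain ⟨P, hP⟩ := exists_MIrr_dvd hf h1
    exact h P hP
  · rintro rfl
    exact ⟨monic_one, fun P hP => P.prime.not_isUnit (isUnit_of_dvd_one hP)⟩

lemma isCoprime_of_mem_smoothMonics {S : Finset (MIrr q)} {P : MIrr q} (hP : P ∉ S) {f : Fqx q}
    (hf : f ∈ smoothMonics S) (k : ℕ) : IsCoprime (P.1 ^ k) f :=
  (P.2.2.coprime_iff_not_dvd.2 fun h => hP (hf.2 P h)).pow_left

open scoped Classical in
lemma smoothMonics_insert_bijOn {S : Finset (MIrr q)} {P : MIrr q} (hP : P ∉ S) :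
    Set.BijOn (fun x : ℕ × Fqx q => P.1 ^ x.1 * x.2) (Set.univ ×ˢ smoothMonics S)
      (smoothMonics (insert P S)) := by
  refine ⟨?_, ?_, ?_⟩
  · rintro ⟨k, f⟩ ⟨-, hf⟩
    refine ⟨(P.2.1.pow k).mul hf.1, fun Q hQ => ?_⟩
    rcases Q.prime.dvd_or_dvd hQ with h | h
    · rw [MIrr.eq_of_dvd (Q.prime.dvd_of_dvd_pow h)]
      exact Finset.mem_insert_self _ _
    · exact Finset.mem_insert_of_mem (hf.2 Q h)
  · rintro ⟨k, f⟩ ⟨-, hf⟩ ⟨l, g⟩ ⟨-, hg⟩ h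
    have hle : ∀ {k l : ℕ} {f g : Fqx q}, f ∈ smoothMonics S → g ∈ smoothMonics S →
        P.1 ^ k * f = P.1 ^ l * g → k ≤ l := by
      intro k l f g hf hg h
      have h1 : P.1 ^ k ∣ P.1 ^ l :=
        (isCoprime_of_mem_smoothMonics hP hg k).dvd_of_dvd_mul_right (h ▸ dvd_mul_right _ _)
      exact (pow_dvd_pow_iff P.prime.ne_zero P.prime.not_isUnit).1 h1
    obtain rfl : k = l := le_antisymm (hle hf hg h) (hle hg hf h.symm)
    simpa [pow_ne_zero k P.prime.ne_zero] using h
  · intro f hf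
    obtain ⟨k, g, hg, rfl⟩ := WfDvdMonoid.max_power_factor hf.1.ne_zero P.2.2
    have hgm : g.Monic := (P.2.1.pow k).of_mul_monic_left hf.1
    refine ⟨(k, g), ⟨trivial, hgm, fun Q hQ => ?_⟩, rfl⟩
    rcases Finset.mem_insert.1 (hf.2 Q (hQ.mul_left _)) with rfl | h
    · exact absurd hQ hg
    · exact h

lemma hasSum_smoothMonics {F : Fqx q → ℂ} (h1 : F 1 = 1)
    (hmul : ∀ f g : Fqx q, f.Monic → g.Monic → IsCoprime f g → F (f * g) = F f * F g)
    (S : Finset (MIrr q)) (hs : ∀ P ∈ S, Summable fun k : ℕ => ‖F (P.1 ^ k)‖) :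
    (Summable fun f : smoothMonics S => ‖F f‖) ∧
      HasSum (fun f : smoothMonics S => F f) (∏ P ∈ S, ∑' k : ℕ, F (P.1 ^ k)) := by
  classical
  induction S using Finset.induction_on with
  | empty =>
    rw [smoothMonics_empty]
    refine ⟨(hasSum_unique _).summable, ?_⟩
    simpa [h1] using hasSum_unique (fun f : ({1} : Set (Fqx q)) => F f)
  | insert P S hP ih =>
    obtain ⟨ih1, ih2⟩ := ih fun Q hQ => hs Q (Finset.mem_insert_of_mem hQ)
    have hsP := hs P (Finset.mem_insert_self _ _)
    let e : ℕ × smoothMonics S ≃ smoothMonics (insert P S) :=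
      ((Equiv.Set.univ ℕ).symm.prodCongr (Equiv.refl _)).trans
        ((Equiv.Set.prod Set.univ (smoothMonics S)).symm.trans
          (smoothMonics_insert_bijOn hP).equiv)
    have he : ∀ x : ℕ × smoothMonics S, F (e x) = F (P.1 ^ x.1) * F x.2 := by
      intro x
      have hx : (e x : Fqx q) = P.1 ^ x.1 * x.2.1 := rfl
      rw [hx]
      exact hmul (P.1 ^ x.1) x.2.1 (P.2.1.pow _) x.2.2.1 (isCoprime_of_mem_smoothMonics hP x.2.2 _)
    have hsum : Summable fun x : ℕ × smoothMonics S => ‖F (P.1 ^ x.1) * F x.2‖ :=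
      Summable.mul_norm (f := fun k : ℕ => F (P.1 ^ k)) (g := fun f : smoothMonics S => F f) hsP ih1
    constructor
    · rw [← e.summable_iff]
      simpa only [Function.comp_def, he] using hsum
    · rw [Finset.prod_insert hP, ← e.hasSum_iff]
      simp only [Function.comp_def, he]
      rw [← ih2.tsum_eq, tsum_mul_tsum_of_summable_norm hsP ih1]
      exact hsum.of_norm.hasSum

lemma MIrr.pow_injective (P : MIrr q) : Function.Injective fun k : ℕ => P.1 ^ k := by
  intro k l h
  have := congrArg natDegree h
  simp only [natDegree_pow] at this
  exact Nat.eq_of_mul_eq_mul_right P.natDegree_pos this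

lemma summable_norm_prime_powers {F : Fqx q → ℂ}
    (hs : Summable fun f : {f : Fqx q // f.Monic} => ‖F f‖) (P : MIrr q) :
    Summable fun k : ℕ => ‖F (P.1 ^ k)‖ := by
  have hinj : Function.Injective fun k : ℕ => (⟨P.1 ^ k, P.2.1.pow k⟩ : {f : Fqx q // f.Monic}) := by
    intro k l h
    have h' := congrArg (fun x => x.1) h
    dsimp only at h'
    exact P.pow_injective h'
  have h := hs.comp_injective hinj
  simpa only [Function.comp_def] using h

/-- The Euler product of an absolutely summable multiplicative function on monic polynomials. -/
theorem hasProd_eulerProduct {F : Fqx q → ℂ} (h1 : F 1 = 1)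
    (hmul : ∀ f g : Fqx q, f.Monic → g.Monic → IsCoprime f g → F (f * g) = F f * F g)
    (hs : Summable fun f : {f : Fqx q // f.Monic} => ‖F f‖) :
    HasProd (fun P : MIrr q => ∑' k : ℕ, F (P.1 ^ k)) (∑' f : {f : Fqx q // f.Monic}, F f) := by
  classical
  have key : ∀ S : Finset (MIrr q), ∏ P ∈ S, ∑' k : ℕ, F (P.1 ^ k) =
      ∑' f : {f : Fqx q // f.Monic}, (smoothMonics S).indicator F f := by
    intro S
    rw [← (hasSum_smoothMonics h1 hmul S fun P _ => summable_norm_prime_powers hs P).2.tsum_eq,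
      tsum_subtype (smoothMonics S) F]
    symm
    refine tsum_subtype_eq_of_support_subset (s := {f : Fqx q | f.Monic}) ?_
    exact Set.support_indicator_subset.trans fun f hf => hf.1
  rw [HasProd]
  simp only [key]
  refine tendsto_tsum_of_dominated_convergence hs (fun f => ?_) (Filter.Eventually.of_forall
    fun S f => norm_indicator_le_norm_self _ _)
  refine tendsto_const_nhds.congr' ?_
  filter_upwards [Filter.eventually_ge_atTop (monicFactors f.1)] with S hS
  rw [Set.indicator_of_mem]
  exact ⟨f.2, fun P hP => hS ((mem_monicFactors f.2.ne_zero).2 hP)⟩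

end EulerProduct

section DivisorCount

variable {q : ℕ} [Fact q.Prime]

lemma dk_two_eq_card_divisors {f : Fqx q} (hf : f.Monic) :
    dk q 2 f = Nat.card {d : Fqx q // d.Monic ∧ d ∣ f} := by
  refine Nat.card_congr (Equiv.ofBijective (fun t => ⟨t.1 0, t.2.1 0, ?_⟩) ⟨?_, ?_⟩)
  · have h := t.2.2
    rw [Fin.prod_univ_two] at h
    exact ⟨_, h.symm⟩
  · rintro ⟨t, ht, hft⟩ ⟨s, hs, hfs⟩ h
    have h0 : t 0 = s 0 := congrArg (fun x => x.1) h
    rw [Fin.prod_univ_two] at hft hfs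
    have h1 : t 1 = s 1 := by
      apply mul_left_cancel₀ (ht 0).ne_zero
      rw [hft, h0, hfs]
    refine Subtype.ext (funext fun i => ?_)
    fin_cases i
    · exact h0
    · exact h1
  · rintro ⟨d, hd, e, rfl⟩
    refine ⟨⟨![d, e], fun i => ?_, by simp [Fin.prod_univ_two]⟩, rfl⟩
    fin_cases i
    · exact hd
    · exact hd.of_mul_monic_left hf

lemma dk_two_le {f : Fqx q} (hf : f.Monic) : dk q 2 f ≤ q ^ (f.natDegree + 1) := by
  classical
  rw [dk_two_eq_card_divisors hf]
  let T := (Finset.range (f.natDegree + 1)).biUnion fun n => monicsOfDegree q n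
  have hT : Nat.card {d : Fqx q // d.Monic ∧ d ∣ f} ≤ Nat.card T := by
    refine Nat.card_le_card_of_injective (fun d => ⟨d.1, ?_⟩) fun a b h => ?_
    · simp only [T, Finset.mem_biUnion, Finset.mem_range, mem_monicsOfDegree]
      exact ⟨d.1.natDegree, Nat.lt_succ_of_le (natDegree_le_of_dvd d.2.2 hf.ne_zero), d.2.1, rfl⟩
    · exact Subtype.ext (congrArg (fun x => x.1) h)
  refine hT.trans ?_
  rw [Nat.card_eq_fintype_card, Fintype.card_coe]
  refine Finset.card_biUnion_le.trans ?_
  simp only [card_monicsOfDegree]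
  have hq := (Fact.out : q.Prime).two_le
  exact (Nat.geomSum_lt hq fun k hk => Finset.mem_range.1 hk).le

lemma exists_monic_dvd_monic_dvd_of_dvd_mul {d f g : Fqx q} (hd : d.Monic) (h : d ∣ f * g) :
    ∃ a b : Fqx q, a.Monic ∧ b.Monic ∧ a ∣ f ∧ b ∣ g ∧ a * b = d := by
  obtain ⟨a, b, ha, hb, rfl⟩ := exists_dvd_and_dvd_of_dvd_mul h
  have hlc : a.leadingCoeff * b.leadingCoeff = 1 := by
    rw [← leadingCoeff_mul]; exact hd
  have ha0 : a.leadingCoeff ≠ 0 := left_ne_zero_of_mul_eq_one hlc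
  have hb0 : b.leadingCoeff ≠ 0 := right_ne_zero_of_mul_eq_one hlc
  refine ⟨a * C b.leadingCoeff, b * C a.leadingCoeff, ?_, ?_, ?_, ?_, ?_⟩
  · rw [Monic, leadingCoeff_mul, leadingCoeff_C, hlc]
  · rw [Monic, leadingCoeff_mul, leadingCoeff_C, mul_comm, hlc]
  · exact (IsUnit.mul_right_dvd (isUnit_C.2 hb0.isUnit)).2 ha
  · exact (IsUnit.mul_right_dvd (isUnit_C.2 ha0.isUnit)).2 hb
  · rw [mul_mul_mul_comm, ← C_mul, mul_comm b.leadingCoeff, hlc, C_1, mul_one]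

lemma dk_two_mul {f g : Fqx q} (hf : f.Monic) (hg : g.Monic) (h : IsCoprime f g) :
    dk q 2 (f * g) = dk q 2 f * dk q 2 g := by
  rw [dk_two_eq_card_divisors (hf.mul hg), dk_two_eq_card_divisors hf, dk_two_eq_card_divisors hg,
    ← Nat.card_prod]
  symm
  refine Nat.card_congr (Equiv.ofBijective
    (fun x => ⟨x.1.1 * x.2.1, x.1.2.1.mul x.2.2.1, mul_dvd_mul x.1.2.2 x.2.2.2⟩) ⟨?_, ?_⟩)
  · rintro ⟨⟨a, ha, haf⟩, ⟨b, hb, hbg⟩⟩ ⟨⟨c, hc, hcf⟩, ⟨d, hd, hdg⟩⟩ he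
    have he : a * b = c * d := congrArg (fun x => x.1) he
    have hac : a ∣ c := (IsCoprime.of_isCoprime_of_dvd_left
      (IsCoprime.of_isCoprime_of_dvd_right h hdg) haf).dvd_of_dvd_mul_right (he ▸ dvd_mul_right a b)
    have hca : c ∣ a := (IsCoprime.of_isCoprime_of_dvd_left
      (IsCoprime.of_isCoprime_of_dvd_right h hbg) hcf).dvd_of_dvd_mul_right (he ▸ dvd_mul_right c d)
    obtain rfl := eq_of_monic_of_associated ha hc (associated_of_dvd_dvd hac hca)
    obtain rfl := mul_left_cancel₀ ha.ne_zero he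
    rfl
  · rintro ⟨d, hd, hdvd⟩
    obtain ⟨a, b, ha, hb, haf, hbg, rfl⟩ := exists_monic_dvd_monic_dvd_of_dvd_mul hd hdvd
    exact ⟨⟨⟨a, ha, haf⟩, ⟨b, hb, hbg⟩⟩, rfl⟩

lemma dk_two_prime_pow (P : MIrr q) (k : ℕ) : dk q 2 (P.1 ^ k) = k + 1 := by
  rw [dk_two_eq_card_divisors (P.2.1.pow k)]
  rw [← Nat.card_fin (k + 1)]
  symm
  refine Nat.card_congr (Equiv.ofBijective
    (fun i : Fin (k + 1) => ⟨P.1 ^ (i : ℕ), P.2.1.pow _, pow_dvd_pow _ (Nat.lt_succ_iff.1 i.2)⟩)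
    ⟨?_, ?_⟩)
  · intro i j h
    exact Fin.ext (P.pow_injective (congrArg (fun x => x.1) h))
  · rintro ⟨d, hd, hdvd⟩
    obtain ⟨i, hi, ha⟩ := (dvd_prime_pow P.prime k).1 hdvd
    exact ⟨⟨i, Nat.lt_succ_of_le hi⟩,
      Subtype.ext (eq_of_monic_of_associated (P.2.1.pow i) hd ha.symm)⟩

end DivisorCount

section EulerPhi

variable {q : ℕ} [Fact q.Prime]

lemma finite_quotient {f : Fqx q} (hf : f.Monic) : Finite (Fqx q ⧸ Ideal.span {f}) := by
  have := (AdjoinRoot.powerBasis' hf).finite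
  exact Module.finite_of_finite (M := AdjoinRoot f) (ZMod q)

lemma card_quotient {f : Fqx q} (hf : f.Monic) :
    Nat.card (Fqx q ⧸ Ideal.span {f}) = q ^ f.natDegree := by
  have := (AdjoinRoot.powerBasis' hf).finite
  have h := Module.natCard_eq_pow_finrank (K := ZMod q) (V := AdjoinRoot f)
  rw [(AdjoinRoot.powerBasis' hf).finrank, AdjoinRoot.powerBasis'_dim, Nat.card_zmod] at h
  exact h

lemma polyPhi_le {f : Fqx q} (hf : f.Monic) : polyPhi q f ≤ q ^ f.natDegree := by
  have := finite_quotient hf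
  rw [← card_quotient hf]
  exact Nat.card_le_card_of_injective _ Units.val_injective

lemma polyPhi_mul {f g : Fqx q} (h : IsCoprime f g) :
    polyPhi q (f * g) = polyPhi q f * polyPhi q g := by
  have hc : IsCoprime (Ideal.span {f}) (Ideal.span {g}) :=
    (Ideal.isCoprime_span_singleton_iff f g).2 h
  rw [polyPhi, ← Ideal.span_singleton_mul_span_singleton, polyPhi, polyPhi, ← Nat.card_prod]
  exact Nat.card_congr ((Units.mapEquiv
    (Ideal.quotientMulEquivQuotientProd _ _ hc).toMulEquiv).trans MulEquiv.prodUnits).toEquiv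

lemma polyPhi_one : polyPhi q 1 = 1 := by
  have := polyPhi_le (q := q) monic_one
  have h : 0 < polyPhi q 1 := by
    have := finite_quotient (q := q) monic_one
    exact Nat.card_pos
  simp at this
  omega

lemma polyPhi_prime_pow_succ (P : MIrr q) (k : ℕ) :
    polyPhi q (P.1 ^ (k + 1)) + q ^ (k * P.1.natDegree) = q ^ ((k + 1) * P.1.natDegree) := by
  have hPm : (Ideal.span {P.1}).IsMaximal :=
    PrincipalIdealRing.isMaximal_of_irreducible P.2.2
  have hfin := finite_quotient (P.2.1.pow (k + 1))
  have hcard := card_quotient (P.2.1.pow (k + 1))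
  have hcardP := card_quotient P.2.1
  rw [natDegree_pow] at hcard
  rw [polyPhi]
  rw [← Ideal.span_singleton_pow] at *
  set I := Ideal.span {P.1} with hI
  have hle : I ^ (k + 1) ≤ I := Ideal.pow_le_self (Nat.succ_ne_zero k)
  let φ := (Ideal.Quotient.factor hle).toAddMonoidHom
  have hφ : Function.Surjective φ := Ideal.Quotient.factor_surjective hle
  have hunit : ∀ x, IsUnit x ↔ x ∉ φ.ker := by
    intro x
    obtain ⟨y, rfl⟩ := Ideal.Quotient.mk_surjective x
    rw [Ideal.Quotient.isUnit_mk_pow_iff_notMem I (Nat.succ_ne_zero k), AddMonoidHom.mem_ker]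
    exact not_congr (Ideal.Quotient.eq_zero_iff_mem).symm
  have hu : Nat.card (Fqx q ⧸ I ^ (k + 1))ˣ = Nat.card {x : Fqx q ⧸ I ^ (k + 1) // ¬ x ∈ φ.ker} := by
    refine Nat.card_congr (Equiv.ofBijective (fun u => ⟨u.1, (hunit _).1 u.isUnit⟩) ⟨?_, ?_⟩)
    · intro u v h
      exact Units.ext (congrArg (fun x => x.1) h)
    · rintro ⟨x, hx⟩
      obtain ⟨u, rfl⟩ := (hunit x).2 hx
      exact ⟨u, rfl⟩
  have h1 : Nat.card {x : Fqx q ⧸ I ^ (k + 1) // x ∈ φ.ker} +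
      Nat.card {x : Fqx q ⧸ I ^ (k + 1) // ¬ x ∈ φ.ker} = q ^ ((k + 1) * P.1.natDegree) := by
    classical
    rw [← Nat.card_sum, ← hcard]
    exact Nat.card_congr (Equiv.sumCompl _)
  have h2 : Nat.card {x : Fqx q ⧸ I ^ (k + 1) // x ∈ φ.ker} = q ^ (k * P.1.natDegree) := by
    have h3 := AddSubgroup.card_eq_card_quotient_mul_card_addSubgroup φ.ker
    rw [Nat.card_congr (QuotientAddGroup.quotientKerEquivOfSurjective φ hφ).toEquiv, hcard,
      hcardP, add_mul, one_mul, pow_add, mul_comm] at h3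
    exact (Nat.eq_of_mul_eq_mul_left (pow_pos (Fact.out : q.Prime).pos _) h3).symm
  rw [hu, ← h1, h2, add_comm]

end EulerPhi

section SmoothSum

variable {q : ℕ} [Fact q.Prime]

lemma natCast_prime_ge_two : (2 : ℝ) ≤ q := by exact_mod_cast (Fact.out : q.Prime).two_le

/-- The completed sum `∑_{C ∣ f^∞} |C|⁻² = ∏_{P ∣ f} (1 - |P|⁻²)⁻¹`. -/
noncomputable def smoothWeight (q : ℕ) [Fact q.Prime] (f : Fqx q) : ℝ :=
  ∏ P ∈ monicFactors f, (1 - ((q : ℝ) ^ (2 * P.1.natDegree))⁻¹)⁻¹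

lemma hasSum_smoothWeight {f : Fqx q} :
    HasSum (fun h : smoothMonics (monicFactors f) => ((q : ℂ) ^ (2 * h.1.natDegree))⁻¹)
      (smoothWeight q f) := by
  have hq := natCast_prime_ge_two (q := q)
  have key : ∀ P : MIrr q, HasSum (fun k : ℕ => ((q : ℂ) ^ (2 * (P.1 ^ k).natDegree))⁻¹)
      (1 - ((q : ℂ) ^ (2 * P.1.natDegree))⁻¹)⁻¹ := by
    intro P
    have h1 : ‖((q : ℂ) ^ (2 * P.1.natDegree))⁻¹‖ < 1 := by
      rw [norm_inv, norm_pow, Complex.norm_natCast]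
      exact inv_lt_one_of_one_lt₀ (one_lt_pow₀ (by linarith) (by have := P.natDegree_pos; omega))
    have h2 : (fun k : ℕ => ((q : ℂ) ^ (2 * (P.1 ^ k).natDegree))⁻¹) =
        fun k : ℕ => (((q : ℂ) ^ (2 * P.1.natDegree))⁻¹) ^ k := by
      funext k
      rw [natDegree_pow, inv_pow, ← pow_mul]
      ring_nf
    rw [h2]
    exact hasSum_geometric_of_norm_lt_one h1
  have hsum : ∀ P : MIrr q, Summable fun k : ℕ => ‖((q : ℂ) ^ (2 * (P.1 ^ k).natDegree))⁻¹‖ :=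
    fun P => (key P).summable.norm
  have h := (hasSum_smoothMonics (F := fun h : Fqx q => ((q : ℂ) ^ (2 * h.natDegree))⁻¹) (by simp)
    (fun a b ha hb _ => by
      rw [ha.natDegree_mul hb, mul_add, pow_add, mul_inv]) (monicFactors f) fun P _ => hsum P).2
  simp only [fun P => (key P).tsum_eq] at h
  convert h
  simp [smoothWeight]

lemma norm_sumCdiv_sub_le {f : Fqx q} (hf : f.Monic) (g : ℕ) :
    ‖sumCdiv q g f - smoothWeight q f‖ ≤ 2 * ((q : ℝ) ^ g)⁻¹ := by
  classical
  have hq := natCast_prime_ge_two (q := q)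
  set F : Fqx q → ℂ := (smoothMonics (monicFactors f)).indicator
    fun h => ((q : ℂ) ^ (2 * h.natDegree))⁻¹ with hF
  have h1 : HasSum F (smoothWeight q f) := hasSum_subtype_iff_indicator.1 hasSum_smoothWeight
  have h2 : HasSum (fun h : {h : Fqx q // h.Monic} => F h) (smoothWeight q f) := by
    refine (hasSum_subtype_iff_of_support_subset (s := {h : Fqx q | h.Monic}) ?_).2 h1
    exact Set.support_indicator_subset.trans fun h hh => hh.1
  have h3 := hasSum_monics_by_degree h2
  have hb : ∀ n, ‖∑ h ∈ monicsOfDegree q n, F h‖ ≤ 1 * ((q : ℝ)⁻¹) ^ n := by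
    intro n
    refine (norm_sum_le _ _).trans ?_
    have : ∀ h ∈ monicsOfDegree q n, ‖F h‖ ≤ ((q : ℝ) ^ (2 * n))⁻¹ := by
      intro h hh
      refine (norm_indicator_le_norm_self _ _).trans ?_
      rw [(mem_monicsOfDegree.1 hh).2]
      simp
    refine (Finset.sum_le_sum this).trans ?_
    rw [Finset.sum_const, card_monicsOfDegree, nsmul_eq_mul, one_mul, two_mul, pow_add]
    push_cast
    rw [mul_inv, ← mul_assoc, mul_inv_cancel₀ (by positivity), one_mul, inv_pow]
  have h4 := norm_sub_le_of_geometric_bound_of_hasSum (inv_lt_one_of_one_lt₀ (by linarith)) hb h3 g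
  have h5 : sumCdiv q g f = ∑ n ∈ Finset.range g, ∑ h ∈ monicsOfDegree q n, F h := by
    rw [sumCdiv, sumMle_sub_one]
    refine Finset.sum_congr rfl fun n _ => Finset.sum_congr rfl fun h hh => ?_
    rw [hF, Set.indicator_apply]
    refine if_congr ?_ rfl rfl
    constructor
    · intro hP
      exact ⟨(mem_monicsOfDegree.1 hh).1, fun P hd =>
        (mem_monicFactors hf.ne_zero).2 (hP P.1 P.2.1 P.2.2 hd)⟩
    · intro hP P hPm hPi hd
      exact (mem_monicFactors hf.ne_zero).1 (hP.2 ⟨P, hPm, hPi⟩ hd)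
  rw [h5]
  refine h4.trans ?_
  rw [one_mul, inv_pow, div_le_iff₀ (by
    have : (q : ℝ)⁻¹ < 1 := inv_lt_one_of_one_lt₀ (by linarith)
    linarith)]
  have h6 : (q : ℝ)⁻¹ ≤ 1 / 2 := by
    rw [inv_eq_one_div]
    exact one_div_le_one_div_of_le (by norm_num) hq
  have h7 : 0 ≤ ((q : ℝ) ^ g)⁻¹ := by positivity
  nlinarith

lemma one_le_smoothWeight (f : Fqx q) : 1 ≤ smoothWeight q f := by
  have hq := natCast_prime_ge_two (q := q)
  refine Finset.one_le_prod fun P _ => ?_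
  have h1 : ((q : ℝ) ^ (2 * P.1.natDegree))⁻¹ < 1 :=
    inv_lt_one_of_one_lt₀ (one_lt_pow₀ (by linarith) (by have := P.natDegree_pos; omega))
  have h2 : 0 < ((q : ℝ) ^ (2 * P.1.natDegree))⁻¹ := by positivity
  exact (one_le_inv₀ (by linarith)).2 (by linarith)

lemma smoothWeight_le_two {f : Fqx q} (hf : f.Monic) : smoothWeight q f ≤ 2 := by
  have h := norm_sumCdiv_sub_le hf 0
  have h0 : sumCdiv q 0 f = 0 := by
    rw [sumCdiv, sumMle_sub_one]
    simp
  rw [h0, zero_sub, norm_neg, Complex.norm_real] at h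
  simpa using (Real.le_norm_self _).trans h

lemma smoothWeight_one : smoothWeight q 1 = 1 := by
  have h : monicFactors (1 : Fqx q) = ∅ := by
    ext P
    simp [mem_monicFactors one_ne_zero, P.prime.not_isUnit, isUnit_iff_dvd_one.symm]
  simp [smoothWeight, h]

lemma smoothWeight_mul {f g : Fqx q} (hf : f.Monic) (hg : g.Monic) (h : IsCoprime f g) :
    smoothWeight q (f * g) = smoothWeight q f * smoothWeight q g := by
  classical
  have hu : monicFactors (f * g) = monicFactors f ∪ monicFactors g := by
    ext P
    rw [Finset.mem_union, mem_monicFactors (hf.mul hg).ne_zero, mem_monicFactors hf.ne_zero,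
      mem_monicFactors hg.ne_zero]
    exact P.prime.dvd_mul
  have hd : Disjoint (monicFactors f) (monicFactors g) := by
    rw [Finset.disjoint_left]
    intro P h1 h2
    rw [mem_monicFactors hf.ne_zero] at h1
    rw [mem_monicFactors hg.ne_zero] at h2
    exact P.prime.not_isUnit (h.isUnit_of_dvd' h1 h2)
  rw [smoothWeight, hu, Finset.prod_union hd, smoothWeight, smoothWeight]

lemma smoothWeight_prime_pow_succ (P : MIrr q) (k : ℕ) :
    smoothWeight q (P.1 ^ (k + 1)) = (1 - ((q : ℝ) ^ (2 * P.1.natDegree))⁻¹)⁻¹ := by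
  have h : monicFactors (P.1 ^ (k + 1)) = {P} := by
    ext Q
    rw [mem_monicFactors (P.2.1.pow _).ne_zero, Finset.mem_singleton]
    constructor
    · exact fun h => MIrr.eq_of_dvd (Q.prime.dvd_of_dvd_pow h)
    · rintro rfl
      exact dvd_pow_self _ (Nat.succ_ne_zero k)
  simp [smoothWeight, h]

end SmoothSum

section Coefficient

variable {q : ℕ} [Fact q.Prime]

/-- The weight `d₂(l²) φ(l²) / |l|²` of the square `l²`. -/
noncomputable def squareWeight (q : ℕ) [Fact q.Prime] (l : Fqx q) : ℝ :=
  dk q 2 (l ^ 2) * polyPhi q (l ^ 2) / (q : ℝ) ^ (2 * l.natDegree)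

/-- The weight of `l²` in the completed main term. -/
noncomputable def mainCoeff (q : ℕ) [Fact q.Prime] (l : Fqx q) : ℝ :=
  squareWeight q l * smoothWeight q (l ^ 2)

lemma squareWeight_nonneg (l : Fqx q) : 0 ≤ squareWeight q l := by
  unfold squareWeight; positivity

lemma squareWeight_le_mainCoeff (l : Fqx q) : squareWeight q l ≤ mainCoeff q l :=
  le_mul_of_one_le_right (squareWeight_nonneg l) (one_le_smoothWeight _)

lemma mainCoeff_nonneg (l : Fqx q) : 0 ≤ mainCoeff q l :=
  (squareWeight_nonneg l).trans (squareWeight_le_mainCoeff l)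

lemma mainCoeff_le {l : Fqx q} (hl : l.Monic) :
    mainCoeff q l ≤ 2 * (q : ℝ) ^ (2 * l.natDegree + 1) := by
  have hq := natCast_prime_ge_two (q := q)
  have h2 := hl.pow 2
  have hd : (dk q 2 (l ^ 2) : ℝ) ≤ (q : ℝ) ^ (2 * l.natDegree + 1) := by
    have := dk_two_le h2
    rw [natDegree_pow] at this
    exact_mod_cast this
  have hp : (polyPhi q (l ^ 2) : ℝ) ≤ (q : ℝ) ^ (2 * l.natDegree) := by
    have := polyPhi_le h2
    rw [natDegree_pow] at this
    exact_mod_cast this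
  have hs : squareWeight q l ≤ (q : ℝ) ^ (2 * l.natDegree + 1) := by
    rw [squareWeight, div_le_iff₀ (by positivity)]
    gcongr
  rw [mainCoeff, mul_comm]
  exact mul_le_mul (smoothWeight_le_two h2) hs (squareWeight_nonneg l) (by norm_num)

lemma mainCoeff_one : mainCoeff q 1 = 1 := by
  have h := dk_two_prime_pow (q := q)
  have h1 : dk q 2 (1 : Fqx q) = 1 := by
    rw [dk_two_eq_card_divisors monic_one]
    have : {d : Fqx q | d.Monic ∧ d ∣ 1} = {1} := by
      ext d
      simp only [Set.mem_ofPred_eq, Set.mem_singleton_iff]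
      constructor
      · rintro ⟨hd, h⟩
        exact hd.eq_one_of_isUnit (isUnit_of_dvd_one h)
      · rintro rfl
        exact ⟨monic_one, dvd_rfl⟩
    have h2 := Set.ncard_singleton (1 : Fqx q)
    rw [← this] at h2
    exact h2
  simp [mainCoeff, squareWeight, smoothWeight_one, polyPhi_one, h1]

lemma mainCoeff_mul {f g : Fqx q} (hf : f.Monic) (hg : g.Monic) (h : IsCoprime f g) :
    mainCoeff q (f * g) = mainCoeff q f * mainCoeff q g := by
  have h2 : IsCoprime (f ^ 2) (g ^ 2) := h.pow
  rw [mainCoeff, mainCoeff, mainCoeff, squareWeight, squareWeight, squareWeight, mul_pow,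
    dk_two_mul (hf.pow 2) (hg.pow 2) h2, polyPhi_mul h2, smoothWeight_mul (hf.pow 2) (hg.pow 2) h2,
    hf.natDegree_mul hg, mul_add 2, pow_add]
  push_cast
  have hq := natCast_prime_ge_two (q := q)
  field_simp

lemma mainCoeff_prime_pow_succ (P : MIrr q) (k : ℕ) :
    mainCoeff q (P.1 ^ (k + 1)) =
      (q : ℝ) ^ P.1.natDegree / ((q : ℝ) ^ P.1.natDegree + 1) * (2 * (k + 1) + 1) := by
  have hq := natCast_prime_ge_two (q := q)
  have h := polyPhi_prime_pow_succ P (2 * k + 1)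
  have h2 : (P.1 ^ (k + 1)) ^ 2 = P.1 ^ (2 * k + 1 + 1) := by
    rw [← pow_mul]; ring_nf
  have h' : (polyPhi q (P.1 ^ (2 * k + 1 + 1)) : ℝ) =
      ((q : ℝ) ^ P.1.natDegree) ^ (2 * k + 1) * ((q : ℝ) ^ P.1.natDegree - 1) := by
    have h3 : (polyPhi q (P.1 ^ (2 * k + 1 + 1)) : ℝ) + (q : ℝ) ^ ((2 * k + 1) * P.1.natDegree) =
      (q : ℝ) ^ ((2 * k + 1 + 1) * P.1.natDegree) := by exact_mod_cast h
    rw [mul_comm (2 * k + 1), mul_comm (2 * k + 1 + 1), pow_mul, pow_mul] at h3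
    rw [eq_sub_of_add_eq h3]
    ring
  have hx : 1 < (q : ℝ) ^ P.1.natDegree := one_lt_pow₀ (by linarith) P.natDegree_pos.ne'
  rw [mainCoeff, squareWeight, h2, smoothWeight_prime_pow_succ, dk_two_prime_pow, h',
    natDegree_pow, mul_comm 2 P.1.natDegree, pow_mul _ _ 2,
    show 2 * ((k + 1) * P.1.natDegree) = P.1.natDegree * (2 * k + 2) by ring, pow_mul]
  generalize (q : ℝ) ^ P.1.natDegree = x at hx
  have hx1 : x ≠ 0 := by positivity
  have hx2 : x + 1 ≠ 0 := by positivity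
  have hx3 : x - 1 ≠ 0 := by linarith
  have hx4 : 1 - (x ^ 2)⁻¹ = (x - 1) * (x + 1) / x ^ 2 := by
    field_simp; ring
  rw [hx4]
  push_cast
  field_simp
  ring

end Coefficient

section EulerFactor

variable {q : ℕ} [Fact q.Prime]

/-- The Euler factor of `Bfun` at `P` is `1 + eulerTerm P u`. -/
noncomputable def eulerTerm (P : MIrr q) (u : ℂ) : ℂ :=
  u ^ P.1.natDegree * (u ^ P.1.natDegree - 3) / ((nm q P.1 + 1) * (1 + u ^ P.1.natDegree))

lemma norm_nm_add_one (f : Fqx q) : ‖nm q f + 1‖ = (q : ℝ) ^ f.natDegree + 1 := by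
  have h : nm q f + 1 = (((q : ℝ) ^ f.natDegree + 1 : ℝ) : ℂ) := by
    simp [nm]
  rw [h, Complex.norm_real, Real.norm_of_nonneg (by positivity)]

lemma one_add_pow_ne_zero {u : ℂ} (hu : ‖u‖ < 1) {n : ℕ} (hn : n ≠ 0) : 1 + u ^ n ≠ 0 := by
  intro h
  have h1 : u ^ n = -1 := by linear_combination h
  have h2 : ‖u ^ n‖ < 1 := by
    rw [norm_pow]
    exact pow_lt_one₀ (norm_nonneg u) hu hn
  rw [h1] at h2
  simp at h2

lemma norm_eulerTerm_le (P : MIrr q) {u : ℂ} {r : ℝ} (hu : ‖u‖ ≤ r) (hr : r < 1) :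
    ‖eulerTerm P u‖ ≤ 4 * r ^ P.1.natDegree / ((q : ℝ) ^ P.1.natDegree * (1 - r)) := by
  have hq := natCast_prime_ge_two (q := q)
  have hr0 : 0 ≤ r := (norm_nonneg u).trans hu
  have h1 : ‖u ^ P.1.natDegree‖ ≤ r ^ P.1.natDegree := by
    rw [norm_pow]
    exact pow_le_pow_left₀ (norm_nonneg u) hu _
  have h2 : r ^ P.1.natDegree ≤ r := pow_le_of_le_one hr0 hr.le P.natDegree_pos.ne'
  have h3 : ‖u ^ P.1.natDegree - 3‖ ≤ 4 := by
    refine (norm_sub_le _ _).trans ?_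
    rw [Complex.norm_ofNat]
    linarith
  have h4 : 1 - r ≤ ‖1 + u ^ P.1.natDegree‖ := by
    have := norm_sub_norm_le (1 : ℂ) (-u ^ P.1.natDegree)
    rw [norm_one, norm_neg, sub_neg_eq_add] at this
    linarith
  rw [eulerTerm, norm_div, norm_mul, norm_mul, norm_nm_add_one]
  rw [mul_comm]
  have h5 : 0 < 1 - r := by linarith
  gcongr
  linarith

lemma summable_eulerTerm_bound {r : ℝ} (hr0 : 0 ≤ r) (hr : r < 1) :
    Summable fun P : MIrr q =>
      4 * r ^ P.1.natDegree / ((q : ℝ) ^ P.1.natDegree * (1 - r)) := by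
  have hq := natCast_prime_ge_two (q := q)
  have h1 : 0 < 1 - r := by linarith
  let F : Fqx q → ℂ := fun f =>
    ((4 * r ^ f.natDegree / ((q : ℝ) ^ f.natDegree * (1 - r)) : ℝ) : ℂ)
  have hF : ∀ f, ‖F f‖ = 4 * r ^ f.natDegree / ((q : ℝ) ^ f.natDegree * (1 - r)) := by
    intro f
    rw [Complex.norm_real, Real.norm_of_nonneg (by positivity)]
  have hs : Summable fun f : {f : Fqx q // f.Monic} => ‖F f‖ := by
    refine summable_norm_monics_of_le (b := fun n => 4 / (1 - r) * r ^ n)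
      ((summable_geometric_of_lt_one hr0 hr).mul_left _) fun n => le_of_eq ?_
    have h2 : ∀ f ∈ monicsOfDegree q n, ‖F f‖ = 4 * r ^ n / ((q : ℝ) ^ n * (1 - r)) := by
      intro f hf
      rw [hF, (mem_monicsOfDegree.1 hf).2]
    rw [Finset.sum_congr rfl h2, Finset.sum_const, card_monicsOfDegree, nsmul_eq_mul]
    push_cast
    field_simp
  have hinj : Function.Injective fun P : MIrr q => (⟨P.1, P.2.1⟩ : {f : Fqx q // f.Monic}) :=
    fun P Q h => Subtype.ext (congrArg (fun x => x.1) h)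
  have := hs.comp_injective hinj
  simpa only [Function.comp_def, hF] using this

lemma multipliable_eulerTerm {u : ℂ} (hu : ‖u‖ < 1) :
    Multipliable fun P : MIrr q => 1 + eulerTerm P u :=
  multipliable_one_add_of_summable (Summable.of_nonneg_of_le (fun _ => norm_nonneg _)
    (fun P => norm_eulerTerm_le P le_rfl hu) (summable_eulerTerm_bound (norm_nonneg u) hu))

lemma hasProd_Bfun {u : ℂ} (hu : ‖u‖ < 1) :
    HasProd (fun P : MIrr q => 1 + eulerTerm P u) (Bfun q u) :=
  (multipliable_eulerTerm hu).hasProd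

lemma differentiableOn_eulerTerm (P : MIrr q) :
    DifferentiableOn ℂ (eulerTerm P) (Metric.ball 0 1) := by
  have hden : ∀ u ∈ Metric.ball (0 : ℂ) 1, (nm q P.1 + 1) * (1 + u ^ P.1.natDegree) ≠ 0 := by
    intro u hu
    refine mul_ne_zero (norm_ne_zero_iff.1 ?_)
      (one_add_pow_ne_zero (by simpa using hu) P.natDegree_pos.ne')
    rw [norm_nm_add_one]
    positivity
  unfold eulerTerm
  exact DifferentiableOn.div (by fun_prop) (by fun_prop) hden

lemma multipliableLocallyUniformlyOn_eulerTerm :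
    MultipliableLocallyUniformlyOn (fun (P : MIrr q) u => 1 + eulerTerm P u)
      (Metric.ball (0 : ℂ) 1) := by
  use fun u => ∏' P : MIrr q, (1 + eulerTerm P u)
  apply hasProdLocallyUniformlyOn_of_forall_compact Metric.isOpen_ball
  intro K hK hcK
  rcases K.eq_empty_or_nonempty with hN | hN
  · simpa [hasProdUniformlyOn_iff_tendstoUniformlyOn, hN] using tendstoUniformlyOn_empty
  · obtain ⟨u₀, hu₀, _, HB⟩ := hcK.exists_sSup_image_eq_and_ge hN
      (show ContinuousOn (fun u : ℂ ↦ ‖u‖) K by fun_prop)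
    have h1 : ‖u₀‖ < 1 := by simpa using hK hu₀
    exact (summable_eulerTerm_bound (q := q) (norm_nonneg u₀) h1).hasProdUniformlyOn_one_add
      hcK (.of_forall fun P u hu => norm_eulerTerm_le P (HB u hu) h1)
      fun P => (differentiableOn_eulerTerm P).continuousOn.mono hK

/-- `Bfun` is holomorphic on the open unit disc. -/
theorem differentiableOn_Bfun : DifferentiableOn ℂ (Bfun q) (Metric.ball 0 1) :=
  (multipliableLocallyUniformlyOn_eulerTerm (q := q)).hasProdLocallyUniformlyOn.differentiableOn
    (.of_forall fun S => by
      simpa [Finset.prod_fn] using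
        DifferentiableOn.finsetProd (u := S) fun P _ =>
          (differentiableOn_eulerTerm P).const_add 1) Metric.isOpen_ball

end EulerFactor

section DirichletSeries

variable {q : ℕ} [Fact q.Prime]

lemma summable_norm_pow_natDegree {u : ℂ} (hu : q * ‖u‖ < 1) :
    Summable fun f : {f : Fqx q // f.Monic} => ‖u ^ f.1.natDegree‖ := by
  refine summable_norm_monics_of_le (F := fun f => u ^ f.natDegree)
    (b := fun n => (q * ‖u‖) ^ n) (summable_geometric_of_lt_one (by positivity) hu)
    fun n => le_of_eq ?_
  have h2 : ∀ f ∈ monicsOfDegree q n, ‖u ^ f.natDegree‖ = ‖u‖ ^ n := by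
    intro f hf
    rw [norm_pow, (mem_monicsOfDegree.1 hf).2]
  rw [Finset.sum_congr rfl h2, Finset.sum_const, card_monicsOfDegree, nsmul_eq_mul, mul_pow]
  push_cast
  rfl

lemma norm_lt_one_of_mul_norm_lt_one {u : ℂ} (hu : q * ‖u‖ < 1) : ‖u‖ < 1 := by
  have hq := natCast_prime_ge_two (q := q)
  nlinarith [norm_nonneg u]

/-- The Euler product of the zeta function of `F_q[x]`. -/
lemma hasProd_zeta {u : ℂ} (hu : q * ‖u‖ < 1) :
    HasProd (fun P : MIrr q => (1 - u ^ P.1.natDegree)⁻¹) (1 - q * u)⁻¹ := by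
  have hs := summable_norm_pow_natDegree hu
  have h := hasProd_eulerProduct (F := fun f : Fqx q => u ^ f.natDegree) (by simp)
    (fun f g hf hg _ => by rw [hf.natDegree_mul hg, pow_add]) hs
  have h1 := hasSum_monics_by_degree (F := fun f : Fqx q => u ^ f.natDegree) hs.of_norm.hasSum
  have h2 : (fun n => ∑ f ∈ monicsOfDegree q n, u ^ f.natDegree) = fun n => (q * u) ^ n := by
    funext n
    have h3 : ∀ f ∈ monicsOfDegree q n, u ^ f.natDegree = u ^ n := by
      intro f hf
      rw [(mem_monicsOfDegree.1 hf).2]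
    rw [Finset.sum_congr rfl h3, Finset.sum_const, card_monicsOfDegree, nsmul_eq_mul, mul_pow]
    push_cast
    rfl
  rw [h2] at h1
  have h4 := hasSum_geometric_of_norm_lt_one (ξ := (q : ℂ) * u)
    (by rwa [norm_mul, Complex.norm_natCast])
  rw [h1.unique h4] at h
  convert h using 2 with P
  rw [← tsum_geometric_of_norm_lt_one]
  · refine tsum_congr fun k => ?_
    rw [natDegree_pow, mul_comm, pow_mul]
  · rw [norm_pow]
    exact pow_lt_one₀ (norm_nonneg u) (norm_lt_one_of_mul_norm_lt_one hu) P.natDegree_pos.ne'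

/-- The sum of `mainCoeff` over the monic polynomials of degree `n`. -/
noncomputable def mainSum (q : ℕ) [Fact q.Prime] (n : ℕ) : ℝ :=
  ∑ l ∈ monicsOfDegree q n, mainCoeff q l

lemma summable_norm_mainCoeff {u : ℂ} (hu : (q : ℝ) ^ 3 * ‖u‖ < 1) :
    Summable fun f : {f : Fqx q // f.Monic} => ‖(mainCoeff q f : ℂ) * u ^ f.1.natDegree‖ := by
  have hq := natCast_prime_ge_two (q := q)
  refine summable_norm_monics_of_le (F := fun f => (mainCoeff q f : ℂ) * u ^ f.natDegree)
    (b := fun n => 2 * q * ((q : ℝ) ^ 3 * ‖u‖) ^ n)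
    ((summable_geometric_of_lt_one (by positivity) hu).mul_left _) fun n => ?_
  have h2 : ∀ f ∈ monicsOfDegree q n, ‖(mainCoeff q f : ℂ) * u ^ f.natDegree‖ ≤
      2 * (q : ℝ) ^ (2 * n + 1) * ‖u‖ ^ n := by
    intro f hf
    obtain ⟨hfm, rfl⟩ := mem_monicsOfDegree.1 hf
    rw [norm_mul, norm_pow, Complex.norm_real, Real.norm_of_nonneg (mainCoeff_nonneg f)]
    gcongr
    exact mainCoeff_le hfm
  refine (Finset.sum_le_sum h2).trans (le_of_eq ?_)
  rw [Finset.sum_const, card_monicsOfDegree, nsmul_eq_mul, mul_pow]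
  push_cast
  ring

lemma hasSum_mainCoeff_prime_pow (P : MIrr q) {u : ℂ} (hu : ‖u‖ < 1) :
    HasSum (fun k : ℕ => (mainCoeff q (P.1 ^ k) : ℂ) * u ^ (P.1 ^ k).natDegree)
      ((1 - (u ^ 2) ^ P.1.natDegree) * ((1 - u ^ P.1.natDegree)⁻¹) ^ 3 * (1 + eulerTerm P u)) := by
  have hd := P.natDegree_pos.ne'
  have hx : ‖u ^ P.1.natDegree‖ < 1 := by
    rw [norm_pow]
    exact pow_lt_one₀ (norm_nonneg u) hu hd
  have hx1 : 1 + u ^ P.1.natDegree ≠ 0 := one_add_pow_ne_zero hu hd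
  have hx2 : 1 - u ^ P.1.natDegree ≠ 0 := by
    intro h
    rw [← sub_eq_zero.1 h] at hx
    simp at hx
  have hy : nm q P.1 + 1 ≠ 0 := by
    refine norm_ne_zero_iff.1 ?_
    rw [norm_nm_add_one]
    positivity
  have h1 := (((hasSum_coe_mul_geometric_of_norm_lt_one hx).mul_left 2).add
    ((hasSum_geometric_of_norm_lt_one hx).mul_left 3)).mul_left
      (nm q P.1 / (nm q P.1 + 1) * u ^ P.1.natDegree)
  have h2 : (fun k : ℕ => (mainCoeff q (P.1 ^ (k + 1)) : ℂ) * u ^ (P.1 ^ (k + 1)).natDegree) =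
      fun k : ℕ => nm q P.1 / (nm q P.1 + 1) * u ^ P.1.natDegree *
        (2 * (k * (u ^ P.1.natDegree) ^ k) + 3 * (u ^ P.1.natDegree) ^ k) := by
    funext k
    rw [mainCoeff_prime_pow_succ, natDegree_pow, mul_comm (k + 1), pow_mul]
    simp only [nm]
    push_cast
    ring
  rw [← h2] at h1
  have h3 := (hasSum_nat_add_iff
    (f := fun k : ℕ => (mainCoeff q (P.1 ^ k) : ℂ) * u ^ (P.1 ^ k).natDegree) 1).1 h1
  refine (congrArg (HasSum _) ?_).mp h3
  rw [Finset.sum_range_one, pow_zero, mainCoeff_one, natDegree_one, pow_zero, Complex.ofReal_one,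
    eulerTerm, ← pow_mul, mul_comm 2 P.1.natDegree, pow_mul]
  clear h1 h2 h3
  generalize u ^ P.1.natDegree = x at *
  generalize nm q P.1 = y at *
  field_simp
  ring

/-- The generating function of `mainSum`, near the origin. -/
theorem hasSum_mainSum {u : ℂ} (hu : (q : ℝ) ^ 3 * ‖u‖ < 1) :
    HasSum (fun n => (mainSum q n : ℂ) * u ^ n)
      ((1 - q * u ^ 2) * ((1 - q * u)⁻¹) ^ 3 * Bfun q u) := by
  have hq := natCast_prime_ge_two (q := q)
  have hu1 : (q : ℝ) * ‖u‖ < 1 := by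
    refine lt_of_le_of_lt ?_ hu
    gcongr
    exact le_self_pow₀ (by linarith) (by norm_num)
  have hu0 := norm_lt_one_of_mul_norm_lt_one hu1
  have hu2 : (q : ℝ) * ‖u ^ 2‖ < 1 := by
    rw [norm_pow]
    nlinarith [norm_nonneg u]
  have hs := summable_norm_mainCoeff hu
  have hG := hasProd_eulerProduct (F := fun f : Fqx q => (mainCoeff q f : ℂ) * u ^ f.natDegree)
    (by simp [mainCoeff_one])
    (fun f g hf hg h => by
      rw [hf.natDegree_mul hg, pow_add, mainCoeff_mul hf hg h]
      push_cast
      ring) hs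
  simp only [fun P : MIrr q => (hasSum_mainCoeff_prime_pow P hu0).tsum_eq] at hG
  have hL := hG.mul (hasProd_zeta hu2)
  have hZ := hasProd_zeta hu1
  have hR := ((hZ.mul hZ).mul hZ).mul (hasProd_Bfun (q := q) hu0)
  have hfac : ∀ P : MIrr q, (1 - (u ^ 2) ^ P.1.natDegree) * ((1 - u ^ P.1.natDegree)⁻¹) ^ 3 *
      (1 + eulerTerm P u) * (1 - (u ^ 2) ^ P.1.natDegree)⁻¹ =
      (1 - u ^ P.1.natDegree)⁻¹ * (1 - u ^ P.1.natDegree)⁻¹ * (1 - u ^ P.1.natDegree)⁻¹ *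
        (1 + eulerTerm P u) := by
    intro P
    have hne : 1 - (u ^ 2) ^ P.1.natDegree ≠ 0 := by
      intro h
      have h1 : ‖(u ^ 2) ^ P.1.natDegree‖ < 1 := by
        rw [norm_pow]
        exact pow_lt_one₀ (norm_nonneg _) (norm_lt_one_of_mul_norm_lt_one hu2)
          P.natDegree_pos.ne'
      rw [← sub_eq_zero.1 h] at h1
      simp at h1
    field_simp
  simp only [hfac] at hL
  have heq := hL.unique hR
  have hne : 1 - (q : ℂ) * u ^ 2 ≠ 0 := by
    intro h
    have h1 : ‖(q : ℂ) * u ^ 2‖ < 1 := by rwa [norm_mul, Complex.norm_natCast]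
    rw [← sub_eq_zero.1 h] at h1
    simp at h1
  have h1 := hasSum_monics_by_degree
    (F := fun f : Fqx q => (mainCoeff q f : ℂ) * u ^ f.natDegree) hs.of_norm.hasSum
  have h2 : (∑' f : {f : Fqx q // f.Monic}, (mainCoeff q f : ℂ) * u ^ f.1.natDegree) =
      (1 - q * u ^ 2) * ((1 - q * u)⁻¹) ^ 3 * Bfun q u := by
    rw [← div_eq_mul_inv, div_eq_iff hne] at heq
    rw [heq]
    ring
  rw [h2] at h1
  convert h1 using 2 with n
  rw [mainSum, Complex.ofReal_sum, Finset.sum_mul]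
  refine Finset.sum_congr rfl fun f hf => ?_
  rw [(mem_monicsOfDegree.1 hf).2]

end DirichletSeries

section PowerSeries

lemma coeff_eq_of_hasSum_mul_pow {x y : ℕ → ℂ} {f : ℂ → ℂ} {δ : ℝ} (hδ : 0 < δ)
    (hx : ∀ v : ℂ, ‖v‖ < δ → HasSum (fun n => x n * v ^ n) (f v))
    (hy : ∀ v : ℂ, ‖v‖ < δ → HasSum (fun n => y n * v ^ n) (f v)) : x = y := by
  have key : ∀ z : ℕ → ℂ, (∀ v : ℂ, ‖v‖ < δ → HasSum (fun n => z n * v ^ n) (f v)) →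
      HasFPowerSeriesAt f (FormalMultilinearSeries.ofScalars ℂ z) 0 := by
    intro z hz
    rw [hasFPowerSeriesAt_iff]
    filter_upwards [Metric.ball_mem_nhds (0 : ℂ) hδ] with v hv
    simpa only [FormalMultilinearSeries.coeff_ofScalars, smul_eq_mul, zero_add, mul_comm] using
      hz v (by simpa using hv)
  have h := (key x hx).eq_formalMultilinearSeries (key y hy)
  funext n
  rw [← FormalMultilinearSeries.coeff_ofScalars (𝕜 := ℂ) (p := x), h,
    FormalMultilinearSeries.coeff_ofScalars]

/-- At natural numbers `j`, the coefficient of `v ^ j` in `(1 - c v²) (1 - v)⁻⁴`. -/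
noncomputable def kernelPoly (c x : ℂ) : ℂ :=
  (x + 1) * (x + 2) * (x + 3) / 6 - c * ((x - 1) * x * (x + 1) / 6)

lemma hasSum_kernelPoly (c : ℂ) {v : ℂ} (hv : ‖v‖ < 1) :
    HasSum (fun j : ℕ => kernelPoly c j * v ^ j) ((1 - c * v ^ 2) * ((1 - v)⁻¹) ^ 4) := by
  have h1 : HasSum (fun j : ℕ => ((j : ℂ) + 1) * (j + 2) * (j + 3) / 6 * v ^ j)
      (((1 - v)⁻¹) ^ 4) := by
    have h := hasSum_choose_mul_geometric_of_norm_lt_one 3 hv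
    have h2 : (fun n : ℕ => (((n + 3).choose 3 : ℕ) : ℂ) * v ^ n) =
        fun j : ℕ => ((j : ℂ) + 1) * (j + 2) * (j + 3) / 6 * v ^ j := by
      funext n
      have h3 := Nat.descFactorial_eq_factorial_mul_choose (n + 3) 3
      simp only [Nat.descFactorial, Nat.factorial] at h3
      have h4 : (((n + 1) * (n + 2) * (n + 3) : ℕ) : ℂ) = ((6 * (n + 3).choose 3 : ℕ) : ℂ) := by
        congr 1
        simp at h3
        linarith
      push_cast at h4
      rw [h4]
      ring
    rw [h2, one_div, ← inv_pow] at h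
    exact h
  have h2 : HasSum (fun j : ℕ => ((j : ℂ) - 1) * j * (j + 1) / 6 * v ^ j)
      (v ^ 2 * ((1 - v)⁻¹) ^ 4) := by
    have h3 : (fun j : ℕ => v ^ 2 * (((j : ℂ) + 1) * (j + 2) * (j + 3) / 6 * v ^ j)) =
        fun j : ℕ => (((j + 2 : ℕ) : ℂ) - 1) * (j + 2 : ℕ) * ((j + 2 : ℕ) + 1) / 6 * v ^ (j + 2) := by
      funext j
      push_cast
      ring
    have h4 := h1.mul_left (v ^ 2)
    rw [h3] at h4
    have h5 := (hasSum_nat_add_iff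
      (f := fun j : ℕ => ((j : ℂ) - 1) * j * (j + 1) / 6 * v ^ j) 2).1 h4
    simpa [Finset.sum_range_succ] using h5
  have h3 := h1.sub (h2.mul_left c)
  have h4 : (fun j : ℕ => ((j : ℂ) + 1) * (j + 2) * (j + 3) / 6 * v ^ j -
      c * (((j : ℂ) - 1) * j * (j + 1) / 6 * v ^ j)) = fun j : ℕ => kernelPoly c j * v ^ j := by
    funext j
    rw [kernelPoly]
    ring
  rw [h4] at h3
  rwa [show (1 - c * v ^ 2) * ((1 - v)⁻¹) ^ 4 =
    ((1 - v)⁻¹) ^ 4 - c * (v ^ 2 * ((1 - v)⁻¹) ^ 4) by ring]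

lemma hasSum_convolution {x y : ℕ → ℂ} {v s t : ℂ} (hx : HasSum (fun n => x n * v ^ n) s)
    (hy : HasSum (fun n => y n * v ^ n) t) :
    HasSum (fun n => (∑ k ∈ Finset.range (n + 1), x k * y (n - k)) * v ^ n) (s * t) := by
  have h := hasSum_sum_range_mul_of_summable_norm hx.summable.norm hy.summable.norm
  rw [hx.tsum_eq, hy.tsum_eq] at h
  refine (congrArg (fun F => HasSum F (s * t)) (funext fun n => ?_)).mpr h
  rw [Finset.sum_mul]
  refine Finset.sum_congr rfl fun k hk => ?_
  rw [mul_mul_mul_comm, ← pow_add, Nat.add_sub_cancel' (Nat.lt_succ_iff.1 (Finset.mem_range.1 hk))]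

/-- Partial sums of the coefficients of `(1 - c v²) (1 - v)⁻³ A(v)`. -/
lemma sum_range_eq_sum_kernelPoly {m a : ℕ → ℂ} {A : ℂ → ℂ} {c : ℂ} {δ : ℝ} (hδ : 0 < δ)
    (hδ1 : δ ≤ 1) (ha : ∀ v : ℂ, ‖v‖ < δ → HasSum (fun n => a n * v ^ n) (A v))
    (hm : ∀ v : ℂ, ‖v‖ < δ →
      HasSum (fun n => m n * v ^ n) ((1 - c * v ^ 2) * ((1 - v)⁻¹) ^ 3 * A v)) (M : ℕ) :
    ∑ n ∈ Finset.range M, m n =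
      ∑ k ∈ Finset.range M, a k * kernelPoly c ((M : ℂ) - 1 - k) := by
  have hgeom : ∀ v : ℂ, ‖v‖ < δ → HasSum (fun n : ℕ => (fun _ => 1 : ℕ → ℂ) n * v ^ n) (1 - v)⁻¹ := by
    intro v hv
    simpa only [one_mul] using hasSum_geometric_of_norm_lt_one (hv.trans_le hδ1)
  have h := coeff_eq_of_hasSum_mul_pow
    (x := fun n => ∑ k ∈ Finset.range (n + 1), m k * (fun _ => 1 : ℕ → ℂ) (n - k))
    (y := fun n => ∑ k ∈ Finset.range (n + 1), a k * (fun j : ℕ => kernelPoly c j) (n - k))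
    (f := fun v => A v * ((1 - c * v ^ 2) * ((1 - v)⁻¹) ^ 4)) hδ
    (fun v hv => by
      have h1 := hasSum_convolution (hm v hv) (hgeom v hv)
      rwa [show (1 - c * v ^ 2) * ((1 - v)⁻¹) ^ 3 * A v * (1 - v)⁻¹ =
        A v * ((1 - c * v ^ 2) * ((1 - v)⁻¹) ^ 4) by ring] at h1)
    (fun v hv => hasSum_convolution (y := fun j : ℕ => kernelPoly c j)
      (ha v hv) (hasSum_kernelPoly c (hv.trans_le hδ1)))
  cases M with
  | zero => simp
  | succ n =>
    have h1 := congrFun h n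
    simp only [mul_one] at h1
    rw [h1]
    refine Finset.sum_congr rfl fun k hk => ?_
    rw [Nat.cast_sub (Nat.lt_succ_iff.1 (Finset.mem_range.1 hk))]
    push_cast
    ring_nf

lemma differentiableOn_iteratedDeriv {f : ℂ → ℂ} {s : Set ℂ} (hs : IsOpen s)
    (hf : DifferentiableOn ℂ f s) (k : ℕ) : DifferentiableOn ℂ (iteratedDeriv k f) s := by
  induction k with
  | zero => rwa [iteratedDeriv_zero]
  | succ k ih =>
    rw [iteratedDeriv_succ]
    exact ih.deriv hs

/-- Termwise differentiation of the Taylor series. -/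
lemma hasSum_descFactorial_mul_taylor {f : ℂ → ℂ} (hf : DifferentiableOn ℂ f (Metric.ball 0 1))
    {u : ℂ} (hu : ‖u‖ < 1) (k : ℕ) :
    HasSum (fun n : ℕ => (n.descFactorial k : ℂ) * (iteratedDeriv n f 0 / n.factorial * u ^ n))
      (u ^ k * iteratedDeriv k f u) := by
  have h := (Complex.hasSum_taylorSeries_on_ball
    (differentiableOn_iteratedDeriv Metric.isOpen_ball hf k)
    (z := u) (by simpa using hu)).mul_left (u ^ k)
  have h1 : (fun n : ℕ => u ^ k * ((n.factorial : ℂ)⁻¹ • (u - 0) ^ n •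
      iteratedDeriv n (iteratedDeriv k f) 0)) = fun n : ℕ => ((n + k).descFactorial k : ℂ) *
        (iteratedDeriv (n + k) f 0 / (n + k).factorial * u ^ (n + k)) := by
    funext n
    have h2 : iteratedDeriv n (iteratedDeriv k f) = iteratedDeriv (n + k) f := by
      simp only [iteratedDeriv_eq_iterate, Function.iterate_add_apply]
    have h3 := Nat.factorial_mul_descFactorial (Nat.le_add_left k n)
    rw [Nat.add_sub_cancel] at h3
    rw [h2, ← h3]
    have h4 : (n.factorial : ℂ) ≠ 0 := by exact_mod_cast n.factorial_ne_zero
    have h5 : ((n + k).descFactorial k : ℂ) ≠ 0 := by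
      exact_mod_cast (Nat.descFactorial_pos.2 (Nat.le_add_left k n)).ne'
    push_cast
    simp only [smul_eq_mul, sub_zero]
    field_simp
    ring
  rw [h1] at h
  have h2 := (hasSum_nat_add_iff (f := fun n : ℕ => (n.descFactorial k : ℂ) *
    (iteratedDeriv n f 0 / n.factorial * u ^ n)) k).1 h
  rwa [Finset.sum_eq_zero, add_zero] at h2
  intro n hn
  rw [Nat.descFactorial_of_lt (Finset.mem_range.1 hn)]
  simp

end PowerSeries

section Asymptotics

variable {q : ℕ} [Fact q.Prime]

/-- The Taylor coefficients at the origin of `v ↦ Bfun q (v / q)`. -/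
noncomputable def scaledCoeff (q n : ℕ) : ℂ :=
  iteratedDeriv n (Bfun q) 0 / n.factorial * (1 / (q : ℂ)) ^ n

/-- The scaled derivatives `B⁽ʲ⁾(1/q) / qʲ`. -/
noncomputable def scaledDeriv (q j : ℕ) : ℂ :=
  (1 / (q : ℂ)) ^ j * iteratedDeriv j (Bfun q) (1 / q)

lemma norm_one_div_natCast_lt_one : ‖1 / (q : ℂ)‖ < 1 := by
  have hq := natCast_prime_ge_two (q := q)
  rw [norm_div, norm_one, Complex.norm_natCast]
  exact (div_lt_one (by linarith)).2 (by linarith)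

lemma hasSum_descFactorial_mul_scaledCoeff (j : ℕ) :
    HasSum (fun n : ℕ => (n.descFactorial j : ℂ) * scaledCoeff q n) (scaledDeriv q j) :=
  hasSum_descFactorial_mul_taylor differentiableOn_Bfun norm_one_div_natCast_lt_one j

lemma summable_norm_scaledCoeff_descFactorial (j : ℕ) {r : ℝ} (hr0 : 0 ≤ r) (hr : r < q) :
    Summable fun n : ℕ => (n.descFactorial j : ℝ) * (‖scaledCoeff q n‖ * r ^ n) := by
  have hq := natCast_prime_ge_two (q := q)
  have hu : ‖((r / q : ℝ) : ℂ)‖ < 1 := by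
    rw [Complex.norm_real, Real.norm_of_nonneg (by positivity)]
    exact (div_lt_one (by linarith)).2 hr
  refine (hasSum_descFactorial_mul_taylor (differentiableOn_Bfun (q := q)) hu
    j).summable.norm.congr fun n => ?_
  rw [scaledCoeff, norm_mul, norm_mul, norm_mul, Complex.norm_natCast, norm_pow, norm_pow,
    Complex.norm_real, Real.norm_of_nonneg (by positivity), norm_div (1 : ℂ), norm_one,
    Complex.norm_natCast]
  ring

lemma hasSum_scaledCoeff {v : ℂ} (hv : ‖v‖ < q) :
    HasSum (fun n => scaledCoeff q n * v ^ n) (Bfun q (1 / q * v)) := by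
  have hq := natCast_prime_ge_two (q := q)
  have hu : ‖1 / (q : ℂ) * v‖ < 1 := by
    rw [norm_mul, norm_div, norm_one, Complex.norm_natCast, one_div, inv_mul_eq_div]
    exact (div_lt_one (by linarith)).2 hv
  have h := hasSum_descFactorial_mul_taylor (differentiableOn_Bfun (q := q)) hu 0
  simp only [Nat.descFactorial_zero, Nat.cast_one, one_mul, pow_zero, iteratedDeriv_zero] at h
  refine (congrArg (fun F => HasSum F (Bfun q (1 / q * v))) (funext fun n => ?_)).mpr h
  rw [scaledCoeff, mul_pow, mul_assoc]

/-- The partial sums of the coefficients of the main generating function. -/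
lemma sum_mainSum_eq (M : ℕ) :
    ∑ n ∈ Finset.range M, (mainSum q n : ℂ) * (1 / (q : ℂ)) ^ n =
      ∑ k ∈ Finset.range M, scaledCoeff q k * kernelPoly (1 / q) ((M : ℂ) - 1 - k) := by
  have hq := natCast_prime_ge_two (q := q)
  have hq0 : (q : ℂ) ≠ 0 := by
    intro h
    rw [Nat.cast_eq_zero] at h
    simp [h] at hq
    linarith
  refine sum_range_eq_sum_kernelPoly (δ := ((q : ℝ) ^ 2)⁻¹)
    (A := fun v => Bfun q (1 / q * v)) (by positivity)
    (inv_le_one_of_one_le₀ (one_le_pow₀ (by linarith))) (fun v hv => ?_) (fun v hv => ?_) M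
  · refine hasSum_scaledCoeff (hv.trans ?_)
    exact lt_of_le_of_lt (inv_le_one_of_one_le₀ (one_le_pow₀ (by linarith))) (by linarith)
  · have hu : (q : ℝ) ^ 3 * ‖1 / (q : ℂ) * v‖ < 1 := by
      rw [norm_mul, norm_div, norm_one, Complex.norm_natCast]
      have hq2 : (0 : ℝ) < (q : ℝ) ^ 2 := by positivity
      have h1 := mul_lt_mul_of_pos_left hv hq2
      rw [mul_inv_cancel₀ hq2.ne'] at h1
      have hq1 : (q : ℝ) ≠ 0 := by positivity
      rwa [show (q : ℝ) ^ 3 * (1 / q * ‖v‖) = (q : ℝ) ^ 2 * ‖v‖ by field_simp]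
    have h := hasSum_mainSum hu
    have h1 : (1 - (q : ℂ) * (1 / q * v) ^ 2) * ((1 - (q : ℂ) * (1 / q * v))⁻¹) ^ 3 =
        (1 - 1 / q * v ^ 2) * ((1 - v)⁻¹) ^ 3 := by
      rw [show (q : ℂ) * (1 / q * v) ^ 2 = 1 / q * v ^ 2 by field_simp,
        show (q : ℂ) * (1 / q * v) = v by field_simp]
    rw [h1] at h
    refine (congrArg (fun F => HasSum F ((1 - 1 / q * v ^ 2) * ((1 - v)⁻¹) ^ 3 *
      Bfun q (1 / q * v))) (funext fun n => ?_)).mpr h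
    rw [mul_pow, mul_assoc]

/-- The polynomial main term of the partial sums `∑_{n ≤ X} mainSum q n / q ^ n`. -/
noncomputable def mainPoly (q : ℕ) (X : ℂ) : ℂ :=
  scaledDeriv q 0 * kernelPoly (1 / q) X
  + scaledDeriv q 1 * (kernelPoly (1 / q) (X - 1) - kernelPoly (1 / q) X)
  + scaledDeriv q 2 * ((kernelPoly (1 / q) (X - 2) - 2 * kernelPoly (1 / q) (X - 1)
      + kernelPoly (1 / q) X) / 2)
  + scaledDeriv q 3 * ((kernelPoly (1 / q) (X - 3) - 3 * kernelPoly (1 / q) (X - 2)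
      + 3 * kernelPoly (1 / q) (X - 1) - kernelPoly (1 / q) X) / 6)

lemma cast_descFactorial_two_three (n : ℕ) :
    (n.descFactorial 2 : ℝ) = n * (n - 1) ∧
      (n.descFactorial 3 : ℝ) = n * (n - 1) * (n - 2) := by
  rcases n with _ | _ | n
  · simp [Nat.descFactorial]
  · simp [Nat.descFactorial]
  · simp only [Nat.descFactorial]
    push_cast [Nat.add_sub_cancel]
    constructor <;> simp <;> ring

lemma hasSum_scaledCoeff_mul_kernelPoly (X : ℂ) :
    HasSum (fun k : ℕ => scaledCoeff q k * kernelPoly (1 / q) (X - k)) (mainPoly q X) := by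
  have h := ((((hasSum_descFactorial_mul_scaledCoeff (q := q) 0).mul_right
    (kernelPoly (1 / q) X)).add
    ((hasSum_descFactorial_mul_scaledCoeff (q := q) 1).mul_right
      (kernelPoly (1 / q) (X - 1) - kernelPoly (1 / q) X))).add
    ((hasSum_descFactorial_mul_scaledCoeff (q := q) 2).mul_right
      ((kernelPoly (1 / q) (X - 2) - 2 * kernelPoly (1 / q) (X - 1)
      + kernelPoly (1 / q) X) / 2))).add
    ((hasSum_descFactorial_mul_scaledCoeff (q := q) 3).mul_right
      ((kernelPoly (1 / q) (X - 3) - 3 * kernelPoly (1 / q) (X - 2)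
      + 3 * kernelPoly (1 / q) (X - 1) - kernelPoly (1 / q) X) / 6))
  refine (congrArg (fun F => HasSum F (mainPoly q X)) (funext fun n => ?_)).mpr h
  obtain ⟨h2, h3⟩ := cast_descFactorial_two_three n
  have h2' : (n.descFactorial 2 : ℂ) = n * (n - 1) := by exact_mod_cast congrArg Complex.ofReal h2
  have h3' : (n.descFactorial 3 : ℂ) = n * (n - 1) * (n - 2) := by
    exact_mod_cast congrArg Complex.ofReal h3
  rw [h2', h3']
  simp only [Nat.descFactorial_zero, Nat.descFactorial_one, kernelPoly]
  push_cast
  ring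

lemma summable_scaledCoeff_mul_cube {r : ℝ} (hr0 : 0 ≤ r) (hr : r < q) :
    Summable fun n : ℕ => ‖scaledCoeff q n‖ * ((n : ℝ) + 4) ^ 3 * r ^ n := by
  have h := fun j => summable_norm_scaledCoeff_descFactorial (q := q) j hr0 hr
  refine ((((h 3).add ((h 2).mul_left 15)).add ((h 1).mul_left 61)).add
    ((h 0).mul_left 64)).congr fun n => ?_
  obtain ⟨h2, h3⟩ := cast_descFactorial_two_three n
  rw [h2, h3]
  simp only [Nat.descFactorial_zero, Nat.descFactorial_one]
  push_cast
  ring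

lemma norm_kernelPoly_le (x : ℂ) : ‖kernelPoly (1 / q) x‖ ≤ (‖x‖ + 3) ^ 3 := by
  have hc := (norm_one_div_natCast_lt_one (q := q)).le
  have hadd : ∀ y : ℂ, ‖y‖ ≤ 3 → ‖x + y‖ ≤ ‖x‖ + 3 := fun y hy =>
    (norm_add_le _ _).trans (by linarith)
  have h1 := hadd 1 (by simp)
  have h2 := hadd 2 (by rw [Complex.norm_ofNat]; norm_num)
  have h3 := hadd 3 (by rw [Complex.norm_ofNat])
  have h4 := hadd (-1) (by simp)
  have h5 := hadd 0 (by simp)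
  rw [add_zero] at h5
  rw [← sub_eq_add_neg] at h4
  rw [kernelPoly]
  refine (norm_sub_le _ _).trans ?_
  rw [norm_mul (1 / (q : ℂ)), norm_div, norm_div (_ * _ * _), norm_mul, norm_mul, norm_mul,
    norm_mul (x - 1), Complex.norm_ofNat]
  have h6 : ‖x + 1‖ * ‖x + 2‖ * ‖x + 3‖ ≤ (‖x‖ + 3) * (‖x‖ + 3) * (‖x‖ + 3) := by gcongr
  have h7 : ‖x - 1‖ * ‖x‖ * ‖x + 1‖ ≤ (‖x‖ + 3) * (‖x‖ + 3) * (‖x‖ + 3) := by gcongr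
  have h8 : ‖1 / (q : ℂ)‖ * (‖x - 1‖ * ‖x‖ * ‖x + 1‖ / 6) ≤
      1 * (‖x - 1‖ * ‖x‖ * ‖x + 1‖ / 6) := by gcongr
  have h9 : 0 ≤ (‖x‖ + 3) * (‖x‖ + 3) * (‖x‖ + 3) := by positivity
  nlinarith

lemma exists_norm_sum_mainSum_sub_mainPoly_le {r : ℝ} (hr1 : 1 ≤ r) (hr : r < q) :
    ∃ K : ℝ, 0 ≤ K ∧ ∀ M : ℕ,
      ‖∑ n ∈ Finset.range M, (mainSum q n : ℂ) * (1 / (q : ℂ)) ^ n - mainPoly q ((M : ℂ) - 1)‖ ≤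
        K * (r ^ M)⁻¹ := by
  have hs := summable_scaledCoeff_mul_cube (q := q) (zero_le_one.trans hr1) hr
  have hr0' : 0 < r := by linarith
  refine ⟨∑' n : ℕ, ‖scaledCoeff q n‖ * ((n : ℝ) + 4) ^ 3 * r ^ n,
    tsum_nonneg fun n => by positivity, fun M => ?_⟩
  have h := hasSum_scaledCoeff_mul_kernelPoly (q := q) ((M : ℂ) - 1)
  rw [sum_mainSum_eq, ← h.tsum_eq, ← h.summable.sum_add_tsum_nat_add M, sub_add_cancel_left,
    norm_neg]
  have hr0 : 0 < r ^ M := by positivity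
  have hs' := (summable_nat_add_iff M).2 hs
  have hb : ∀ k : ℕ, ‖scaledCoeff q (k + M) * kernelPoly (1 / q) ((M : ℂ) - 1 - (k + M : ℕ))‖ ≤
      ‖scaledCoeff q (k + M)‖ * (((k + M : ℕ) : ℝ) + 4) ^ 3 * r ^ (k + M) * (r ^ M)⁻¹ := by
    intro k
    have h1 : ‖kernelPoly (1 / q) ((M : ℂ) - 1 - (k + M : ℕ))‖ ≤ ((k + M : ℕ) + 4 : ℝ) ^ 3 := by
      refine (norm_kernelPoly_le _).trans ?_
      have h2 : ‖(M : ℂ) - 1 - (k + M : ℕ)‖ = (k : ℝ) + 1 := by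
        rw [show (M : ℂ) - 1 - (k + M : ℕ) = -((k + 1 : ℕ) : ℂ) by push_cast; ring, norm_neg,
          Complex.norm_natCast]
        push_cast
        rfl
      rw [h2]
      push_cast
      have : (0 : ℝ) ≤ M := Nat.cast_nonneg M
      gcongr ?_ ^ 3
      linarith
    have h3 : 1 ≤ r ^ k := one_le_pow₀ hr1
    rw [norm_mul, pow_add r k M, mul_assoc _ (r ^ k * r ^ M), mul_assoc (r ^ k),
      mul_inv_cancel₀ hr0.ne', mul_one]
    refine (mul_le_mul_of_nonneg_left h1 (norm_nonneg _)).trans ?_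
    exact le_mul_of_one_le_right (by positivity) h3
  refine (tsum_of_norm_bounded (hs'.mul_right _).hasSum hb).trans ?_
  rw [tsum_mul_right]
  refine mul_le_mul_of_nonneg_right ?_ (by positivity)
  rw [← hs.sum_add_tsum_nat_add M]
  exact le_add_of_nonneg_left (Finset.sum_nonneg fun n _ => by positivity)

lemma exists_sum_mainSum_le :
    ∃ K : ℝ, 0 ≤ K ∧ ∀ M : ℕ,
      ∑ n ∈ Finset.range M, mainSum q n * (1 / (q : ℝ)) ^ n ≤ K * ((M : ℝ) + 3) ^ 3 := by
  have hq := natCast_prime_ge_two (q := q)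
  have hs := summable_norm_scaledCoeff_descFactorial (q := q) 0 zero_le_one (by linarith)
  simp only [Nat.descFactorial_zero, Nat.cast_one, one_mul, one_pow, mul_one] at hs
  refine ⟨∑' n, ‖scaledCoeff q n‖, tsum_nonneg fun n => norm_nonneg _, fun M => ?_⟩
  have h0 : ((∑ n ∈ Finset.range M, mainSum q n * (1 / (q : ℝ)) ^ n : ℝ) : ℂ) =
      ∑ n ∈ Finset.range M, (mainSum q n : ℂ) * (1 / (q : ℂ)) ^ n := by
    push_cast
    rfl
  refine (Real.le_norm_self _).trans ?_
  rw [← Complex.norm_real, h0, sum_mainSum_eq]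
  refine (norm_sum_le _ _).trans ?_
  have h1 : ∀ k ∈ Finset.range M, ‖scaledCoeff q k * kernelPoly (1 / q) ((M : ℂ) - 1 - k)‖ ≤
      ‖scaledCoeff q k‖ * ((M : ℝ) + 3) ^ 3 := by
    intro k hk
    obtain ⟨j, rfl⟩ := Nat.exists_eq_add_of_lt (Finset.mem_range.1 hk)
    rw [norm_mul]
    refine mul_le_mul_of_nonneg_left ((norm_kernelPoly_le _).trans ?_) (norm_nonneg _)
    rw [show ((k + j + 1 : ℕ) : ℂ) - 1 - k = (j : ℂ) by push_cast; ring, Complex.norm_natCast]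
    gcongr
    omega
  refine (Finset.sum_le_sum h1).trans ?_
  rw [← Finset.sum_mul]
  exact mul_le_mul_of_nonneg_right (hs.sum_le_tsum _ fun _ _ => norm_nonneg _) (by positivity)

lemma mainPoly_add_mainPoly_sub_one (X : ℂ) :
    mainPoly q X + mainPoly q (X - 1) = P1val q (2 * X + 1) := by
  have hq0 : (q : ℂ) ≠ 0 := by
    exact_mod_cast (Fact.out : q.Prime).ne_zero
  have h2 : iteratedDeriv 2 (Bfun q) = deriv (deriv (Bfun q)) := by
    rw [iteratedDeriv_eq_iterate]; rfl
  have h3 : iteratedDeriv 3 (Bfun q) = deriv (deriv (deriv (Bfun q))) := by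
    rw [iteratedDeriv_eq_iterate]; rfl
  rw [mainPoly, mainPoly, P1val]
  simp only [scaledDeriv, iteratedDeriv_zero, iteratedDeriv_one, h2, h3, kernelPoly]
  field_simp
  ring

end Asymptotics

section Squares

variable {q : ℕ} [Fact q.Prime]

lemma not_isSquare_of_mem_monicsOfDegree_odd {n : ℕ} {f : Fqx q}
    (hf : f ∈ monicsOfDegree q (2 * n + 1)) : ¬ IsSquare f := by
  rintro ⟨r, rfl⟩
  have h := (mem_monicsOfDegree.1 hf).2
  rw [natDegree_mul'] at h
  · omega
  · have h1 := (mem_monicsOfDegree.1 hf).1.ne_zero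
    exact mul_ne_zero (leadingCoeff_ne_zero.2 (left_ne_zero_of_mul h1))
      (leadingCoeff_ne_zero.2 (left_ne_zero_of_mul h1))

lemma exists_monic_sq_eq {f : Fqx q} (hf : f.Monic) (hs : IsSquare f) :
    ∃ l : Fqx q, l.Monic ∧ l ^ 2 = f := by
  obtain ⟨r, rfl⟩ := hs
  have h1 : r.leadingCoeff * r.leadingCoeff = 1 := by rw [← leadingCoeff_mul]; exact hf
  refine ⟨C r.leadingCoeff * r, ?_, ?_⟩
  · rw [Monic, leadingCoeff_mul, leadingCoeff_C, h1]
  · rw [mul_pow, ← C_pow, sq r.leadingCoeff, h1, C_1, one_mul, sq]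

lemma Polynomial.Monic.eq_of_sq_eq {l m : Fqx q} (hl : l.Monic) (hm : m.Monic)
    (h : l ^ 2 = m ^ 2) : l = m := by
  rcases sq_eq_sq_iff_eq_or_eq_neg.1 h with h | h
  · exact h
  · have h1 : (1 : ZMod q) = -1 := by
      have := congrArg Polynomial.leadingCoeff h
      rwa [leadingCoeff_neg, hl.leadingCoeff, hm.leadingCoeff] at this
    rw [h, ← neg_one_mul, ← C_1, ← C_neg, ← h1, C_1, one_mul]

lemma sum_monicsOfDegree_isSquare (n : ℕ) (H : Fqx q → ℂ)
    [DecidablePred fun f : Fqx q => IsSquare f] :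
    ∑ f ∈ monicsOfDegree q (2 * n), (if IsSquare f then H f else 0) =
      ∑ l ∈ monicsOfDegree q n, H (l ^ 2) := by
  rw [← Finset.sum_filter]
  symm
  refine Finset.sum_bij (fun l _ => l ^ 2) (fun l hl => ?_) (fun l hl m hm h => ?_)
    (fun f hf => ?_) fun _ _ => rfl
  · obtain ⟨h1, h2⟩ := mem_monicsOfDegree.1 hl
    refine Finset.mem_filter.2 ⟨mem_monicsOfDegree.2 ⟨h1.pow 2, ?_⟩, IsSquare.sq l⟩
    rw [h1.natDegree_pow, h2]
  · exact (mem_monicsOfDegree.1 hl).1.eq_of_sq_eq (mem_monicsOfDegree.1 hm).1 h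
  · obtain ⟨hf, hs⟩ := Finset.mem_filter.1 hf
    obtain ⟨h1, h2⟩ := mem_monicsOfDegree.1 hf
    obtain ⟨l, hl, rfl⟩ := exists_monic_sq_eq h1 hs
    rw [hl.natDegree_pow] at h2
    exact ⟨l, mem_monicsOfDegree.2 ⟨hl, by omega⟩, rfl⟩

lemma sum_range_two_mul_isSquare (M : ℕ) (H : Fqx q → ℂ)
    [DecidablePred fun f : Fqx q => IsSquare f] :
    ∑ m ∈ Finset.range (2 * M), ∑ f ∈ monicsOfDegree q m, (if IsSquare f then H f else 0) =
      ∑ n ∈ Finset.range M, ∑ l ∈ monicsOfDegree q n, H (l ^ 2) := by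
  induction M with
  | zero => simp
  | succ M ih =>
    rw [Nat.mul_succ, Finset.sum_range_succ, Finset.sum_range_succ, ih,
      sum_monicsOfDegree_isSquare, Finset.sum_range_succ, add_eq_left]
    exact Finset.sum_eq_zero fun f hf =>
      if_neg (not_isSquare_of_mem_monicsOfDegree_odd hf)

/-- The sum over the squares of degree less than `2 * M` in the main term. -/
noncomputable def truncatedSum (q : ℕ) [Fact q.Prime] (g M : ℕ) : ℂ :=
  ∑ n ∈ Finset.range M, ∑ l ∈ monicsOfDegree q n,
    (squareWeight q l : ℂ) * (1 / (q : ℂ)) ^ n * sumCdiv q g (l ^ 2)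

lemma sum_term_sq_eq (g M : ℕ) :
    ∑ n ∈ Finset.range M, ∑ l ∈ monicsOfDegree q n,
      ((dk q 2 (l ^ 2) : ℂ) * polyPhi q (l ^ 2) /
        (Real.sqrt ((q : ℝ) ^ (3 * (l ^ 2).natDegree)) : ℂ) * sumCdiv q g (l ^ 2)) =
      truncatedSum q g M := by
  refine Finset.sum_congr rfl fun n _ => Finset.sum_congr rfl fun l hl => ?_
  obtain ⟨h1, h2⟩ := mem_monicsOfDegree.1 hl
  have h3 : Real.sqrt ((q : ℝ) ^ (3 * (l ^ 2).natDegree)) = (q : ℝ) ^ (3 * n) := by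
    rw [h1.natDegree_pow, h2, show 3 * (2 * n) = 3 * n * 2 by ring, pow_mul,
      Real.sqrt_sq (by positivity)]
  rw [h3, squareWeight, h2]
  push_cast
  rw [show 3 * n = 2 * n + n by ring, pow_add, one_div, inv_pow]
  ring

lemma Mterm_two_mul (g : ℕ) :
    Mterm q 2 (2 * (g : ℤ)) g =
      (q : ℂ) ^ (2 * g + 1) * (1 - 1 / q) * truncatedSum q g (g + 1) := by
  rw [Mterm, show 2 * (g : ℤ) = ((2 * g + 1 : ℕ) : ℤ) - 1 by push_cast; ring, sumMle_sub_one,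
    ← sum_term_sq_eq, Finset.sum_range_succ, sum_range_two_mul_isSquare,
    sum_monicsOfDegree_isSquare, Finset.sum_range_succ]

lemma Mterm_two_mul_sub_one (g : ℕ) :
    Mterm q 2 (2 * (g : ℤ) - 1) g =
      (q : ℂ) ^ (2 * g + 1) * (1 - 1 / q) * truncatedSum q g g := by
  rw [Mterm, show 2 * (g : ℤ) = ((2 * g : ℕ) : ℤ) by push_cast; ring, sumMle_sub_one,
    ← sum_term_sq_eq, sum_range_two_mul_isSquare]

lemma norm_truncatedSum_sub_le (g M : ℕ) :
    ‖truncatedSum q g M - ∑ n ∈ Finset.range M, (mainSum q n : ℂ) * (1 / (q : ℂ)) ^ n‖ ≤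
      2 * ((q : ℝ) ^ g)⁻¹ * ∑ n ∈ Finset.range M, mainSum q n * (1 / (q : ℝ)) ^ n := by
  rw [truncatedSum, ← Finset.sum_sub_distrib, Finset.mul_sum]
  refine norm_sum_le_of_le _ fun n _ => ?_
  rw [mainSum, Complex.ofReal_sum, Finset.sum_mul, Finset.sum_mul, Finset.mul_sum,
    ← Finset.sum_sub_distrib]
  refine norm_sum_le_of_le _ fun l hl => ?_
  have h1 : (squareWeight q l : ℂ) * (1 / (q : ℂ)) ^ n * sumCdiv q g (l ^ 2) -
      (mainCoeff q l : ℂ) * (1 / (q : ℂ)) ^ n =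
      (squareWeight q l : ℂ) * (1 / (q : ℂ)) ^ n *
        (sumCdiv q g (l ^ 2) - smoothWeight q (l ^ 2)) := by
    rw [mainCoeff]
    push_cast
    ring
  have h2 := norm_sumCdiv_sub_le ((mem_monicsOfDegree.1 hl).1.pow 2) g
  have h3 := squareWeight_le_mainCoeff l
  have h4 := squareWeight_nonneg l
  have h5 := mainCoeff_nonneg l
  rw [h1, norm_mul, norm_mul, Complex.norm_real, Real.norm_of_nonneg h4, norm_pow, norm_div,
    norm_one, Complex.norm_natCast]
  calc squareWeight q l * (1 / (q : ℝ)) ^ n * ‖sumCdiv q g (l ^ 2) - smoothWeight q (l ^ 2)‖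
      ≤ mainCoeff q l * (1 / (q : ℝ)) ^ n * (2 * ((q : ℝ) ^ g)⁻¹) := by gcongr
    _ = _ := by ring

end Squares

section ErrorTerm

variable {q : ℕ} [Fact q.Prime]

lemma exists_add_four_cube_le_rpow {ε : ℝ} (hε : 0 < ε) :
    ∃ K : ℝ, 0 ≤ K ∧ ∀ g : ℕ, ((g : ℝ) + 4) ^ 3 ≤ K * (q : ℝ) ^ ((g : ℝ) * ε) := by
  have hq := natCast_prime_ge_two (q := q)
  have hq0 : (0 : ℝ) < q := by linarith
  set x : ℝ := (q : ℝ) ^ (-ε) with hx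
  have hx0 : 0 < x := Real.rpow_pos_of_pos hq0 _
  have hx1 : x < 1 := Real.rpow_lt_one_of_one_lt_of_neg (by linarith) (by linarith)
  have hs := summable_pow_mul_geometric_of_norm_lt_one (R := ℝ) 3
    (r := x) (by rwa [Real.norm_of_nonneg hx0.le])
  have hn : ∀ n : ℕ, 0 ≤ (n : ℝ) ^ 3 * x ^ n := fun n => by positivity
  refine ⟨(∑' n : ℕ, (n : ℝ) ^ 3 * x ^ n) * (x ^ 4)⁻¹,
    mul_nonneg (tsum_nonneg hn) (by positivity), fun g => ?_⟩
  have h := hs.le_tsum (g + 4) fun n _ => hn n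
  have h1 : (q : ℝ) ^ ((g : ℝ) * ε) = (x ^ g)⁻¹ := by
    rw [hx, ← Real.rpow_natCast, ← Real.rpow_mul hq0.le, ← Real.rpow_neg hq0.le]
    congr 1
    ring
  push_cast at h
  rw [h1, mul_assoc, ← mul_inv, ← div_eq_mul_inv, le_div_iff₀ (by positivity), mul_comm (x ^ 4),
    ← pow_add]
  exact h

lemma exists_ratio {ε : ℝ} (hε : 0 < ε) :
    ∃ r : ℝ, 1 ≤ r ∧ r < q ∧
      ∀ g : ℕ, (q : ℝ) ^ (2 * g) * (r ^ g)⁻¹ ≤ (q : ℝ) ^ ((g : ℝ) * (1 + ε)) := by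
  have hq := natCast_prime_ge_two (q := q)
  have hq0 : (0 : ℝ) < q := by linarith
  have h1 : min ε 1 ≤ 1 := min_le_right _ _
  have h2 : 0 < min ε 1 := lt_min hε one_pos
  refine ⟨(q : ℝ) ^ (1 - min ε 1), Real.one_le_rpow (by linarith) (by linarith), ?_, fun g => ?_⟩
  · nth_rewrite 2 [← Real.rpow_one (q : ℝ)]
    exact Real.rpow_lt_rpow_of_exponent_lt (by linarith) (by linarith)
  · rw [← Real.rpow_natCast, ← Real.rpow_natCast, ← Real.rpow_mul hq0.le, ← Real.rpow_neg hq0.le,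
      ← Real.rpow_add hq0]
    refine Real.rpow_le_rpow_of_exponent_le (by linarith) ?_
    have h3 : (g : ℝ) * min ε 1 ≤ g * ε :=
      mul_le_mul_of_nonneg_left (min_le_left _ _) (Nat.cast_nonneg g)
    push_cast
    linarith

lemma exists_norm_truncatedSum_sub_mainPoly_le {r : ℝ} (hr1 : 1 ≤ r) (hr : r < q) :
    ∃ K : ℝ, 0 ≤ K ∧ ∀ g M : ℕ, g ≤ M → M ≤ g + 1 →
      ‖truncatedSum q g M - mainPoly q ((M : ℂ) - 1)‖ ≤
        K * ((r ^ g)⁻¹ + ((q : ℝ) ^ g)⁻¹ * ((g : ℝ) + 4) ^ 3) := by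
  have hq := natCast_prime_ge_two (q := q)
  obtain ⟨K₁, hK₁, h₁⟩ := exists_norm_sum_mainSum_sub_mainPoly_le hr1 hr
  obtain ⟨K₂, hK₂, h₂⟩ := exists_sum_mainSum_le (q := q)
  refine ⟨2 * K₂ + K₁, by positivity, fun g M hgM hMg => ?_⟩
  have hM : (M : ℝ) ≤ g + 1 := by exact_mod_cast hMg
  have hr0 : 0 < r := by linarith
  have hA : ‖truncatedSum q g M -
      ∑ n ∈ Finset.range M, (mainSum q n : ℂ) * (1 / (q : ℂ)) ^ n‖ ≤
      2 * ((q : ℝ) ^ g)⁻¹ * (K₂ * ((g : ℝ) + 4) ^ 3) := by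
    refine (norm_truncatedSum_sub_le g M).trans
      (mul_le_mul_of_nonneg_left ((h₂ M).trans ?_) (by positivity))
    refine mul_le_mul_of_nonneg_left (pow_le_pow_left₀ (by positivity) ?_ 3) hK₂
    linarith
  have hB := (h₁ M).trans (mul_le_mul_of_nonneg_left
    (inv_anti₀ (by positivity) (pow_le_pow_right₀ hr1 hgM)) hK₁)
  have ha : 0 ≤ (r ^ g)⁻¹ := by positivity
  have hb : 0 ≤ ((q : ℝ) ^ g)⁻¹ * ((g : ℝ) + 4) ^ 3 := by positivity
  calc _ ≤ _ := norm_sub_le_norm_sub_add_norm_sub _ _ _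
    _ ≤ _ := add_le_add hA hB
    _ ≤ _ := by nlinarith [mul_nonneg hK₁ hb, mul_nonneg hK₂ ha]

end ErrorTerm

/-- `M_{2g} + M_{2g-1} = (q^{2g+1}/ζ(2)) P₁(2g+1) + O_ε(q^{g(1+ε)})` with
the explicit polynomial `P₁`. -/
theorem main_term_asymptotic (q : ℕ) [Fact q.Prime] (hq4 : q % 4 = 1)
    (ε : ℝ) (hε : 0 < ε) :
    ∃ K : ℝ, 0 < K ∧ ∀ g : ℕ,
      ‖Mterm q 2 (2 * (g : ℤ)) g + Mterm q 2 (2 * (g : ℤ) - 1) g -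
          (q : ℂ) ^ (2 * g + 1) * (1 - 1 / q) * P1val q ((2 * g + 1 : ℕ) : ℂ)‖ ≤
        K * (q : ℝ) ^ ((g : ℝ) * (1 + ε)) := by
  have hq := natCast_prime_ge_two (q := q)
  have hq0 : (0 : ℝ) < q := by linarith
  obtain ⟨r, hr1, hr, h₁⟩ := exists_ratio (q := q) hε
  obtain ⟨K₂, hK₂, h₂⟩ := exists_add_four_cube_le_rpow (q := q) hε
  obtain ⟨K₃, hK₃, h₃⟩ := exists_norm_truncatedSum_sub_mainPoly_le hr1 hr
  refine ⟨q * (2 * K₃ * (1 + K₂)) + 1, by positivity, fun g => ?_⟩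
  have hP : P1val q ((2 * g + 1 : ℕ) : ℂ) = mainPoly q (((g + 1 : ℕ) : ℂ) - 1) +
      mainPoly q ((g : ℂ) - 1) := by
    push_cast
    rw [add_sub_cancel_right, mainPoly_add_mainPoly_sub_one]
  have hfac : ‖1 - 1 / (q : ℂ)‖ ≤ 1 := by
    have h : (1 : ℂ) - 1 / q = ((1 - 1 / q : ℝ) : ℂ) := by push_cast; rfl
    have h' : 1 / (q : ℝ) ≤ 1 := (div_le_one hq0).2 (by linarith)
    rw [h, Complex.norm_real, Real.norm_of_nonneg (by linarith)]
    linarith [show 0 ≤ 1 / (q : ℝ) by positivity]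
  set R := (r ^ g)⁻¹ + ((q : ℝ) ^ g)⁻¹ * ((g : ℝ) + 4) ^ 3 with hR
  set Y := (q : ℝ) ^ ((g : ℝ) * (1 + ε)) with hY
  have hY0 : 0 < Y := Real.rpow_pos_of_pos hq0 _
  have hRY : (q : ℝ) ^ (2 * g) * R ≤ (1 + K₂) * Y := by
    have h4 : (q : ℝ) ^ (2 * g) * (((q : ℝ) ^ g)⁻¹ * ((g : ℝ) + 4) ^ 3) ≤ K₂ * Y := by
      have h5 : Y = (q : ℝ) ^ g * (q : ℝ) ^ ((g : ℝ) * ε) := by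
        rw [hY, mul_one_add, Real.rpow_add hq0, Real.rpow_natCast]
      have h6 : (q : ℝ) ^ g ≠ 0 := by positivity
      rw [h5, two_mul, pow_add, mul_assoc, mul_inv_cancel_left₀ h6, mul_left_comm]
      exact mul_le_mul_of_nonneg_left (h₂ g) (by positivity)
    rw [hR, mul_add, one_add_mul]
    exact add_le_add (h₁ g) h4
  have hsum : ‖(truncatedSum q g (g + 1) - mainPoly q (((g + 1 : ℕ) : ℂ) - 1)) +
      (truncatedSum q g g - mainPoly q ((g : ℂ) - 1))‖ ≤ 2 * K₃ * R :=
    (norm_add_le_of_le (h₃ g (g + 1) g.le_succ le_rfl) (h₃ g g le_rfl g.le_succ)).trans_eq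
      (by ring)
  rw [Mterm_two_mul, Mterm_two_mul_sub_one, hP, ← mul_add, ← mul_sub, add_sub_add_comm, norm_mul,
    norm_mul, norm_pow, Complex.norm_natCast]
  calc (q : ℝ) ^ (2 * g + 1) * ‖1 - 1 / (q : ℂ)‖ * _
      ≤ (q : ℝ) ^ (2 * g + 1) * 1 * (2 * K₃ * R) := by gcongr
    _ = q * (2 * K₃) * ((q : ℝ) ^ (2 * g) * R) := by ring
    _ ≤ q * (2 * K₃) * ((1 + K₂) * Y) := by gcongr
    _ ≤ (q * (2 * K₃ * (1 + K₂)) + 1) * Y := by nlinarith
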